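/- arXiv:1203.6303 — 2 statements merged into one kernel-verified Lean document; each statement's English description precedes it below -/
import Mathlib

section
/- For every μ > H̄* and every y ∈ ℝ^d: m̄_μ(y) = max{ p·y : p ∈ ℝ^d and H̄₊(p) ≤ μ }, where H̄₊(p) is the deterministic almost-sure value of H̄₊(p,ω). In particular, the sublevel set {p : H̄₊(p) ≤ μ} is nonempty, compact and convex. -/
open MeasureTheory Filter Topology Bornology
open scoped RealInnerProductSpace NNReal

noncomputable section

/-- Euclidean space ℝ^d. -/
abbrev Ed (d : ℕ) := EuclideanSpace ℝ (Fin d)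

/-- The set 𝓛 of globally Lipschitz real-valued functions on ℝ^d. -/
def LipFuns (d : ℕ) : Set (Ed d → ℝ) := {w | ∃ C : ℝ≥0, LipschitzWith C w}

/-- SL⁺ : Lipschitz functions sublinear from below, i.e. liminf_{|y|→∞} w(y)/|y| ≥ 0. -/
def SLplus (d : ℕ) : Set (Ed d → ℝ) :=
  {w | w ∈ LipFuns d ∧ ∀ ε : ℝ, 0 < ε → ∃ R : ℝ, ∀ y : Ed d, R ≤ ‖y‖ → -ε ≤ w y / ‖y‖}

/-- SL⁻ : Lipschitz functions sublinear from above, i.e. limsup_{|y|→∞} w(y)/|y| ≤ 0. -/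
def SLminus (d : ℕ) : Set (Ed d → ℝ) :=
  {w | w ∈ LipFuns d ∧ ∀ ε : ℝ, 0 < ε → ∃ R : ℝ, ∀ y : Ed d, R ≤ ‖y‖ → w y / ‖y‖ ≤ ε}

/-- 𝓢 : Lipschitz functions strictly sublinear at infinity. -/
def Scal (d : ℕ) : Set (Ed d → ℝ) := SLplus d ∩ SLminus d

/-- H̄₊(p) = inf_{w ∈ SL⁺} esssup_y H(p + Dw(y), y). -/
def HbarPlus (d : ℕ) (H : Ed d → Ed d → ℝ) (p : Ed d) : ℝ :=
  sInf {t | ∃ w ∈ SLplus d, t = essSup (fun y => H (p + gradient w y) y) volume}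

/-- H̄₋(p) = inf_{w ∈ SL⁻} esssup_y H(p + Dw(y), y). -/
def HbarMinus (d : ℕ) (H : Ed d → Ed d → ℝ) (p : Ed d) : ℝ :=
  sInf {t | ∃ w ∈ SLminus d, t = essSup (fun y => H (p + gradient w y) y) volume}

/-- Ĥ(p) = inf_{w ∈ 𝓢} esssup_y H(p + Dw(y), y). -/
def Hhat (d : ℕ) (H : Ed d → Ed d → ℝ) (p : Ed d) : ℝ :=
  sInf {t | ∃ w ∈ Scal d, t = essSup (fun y => H (p + gradient w y) y) volume}

/-- H̄* = inf_{w ∈ 𝓛} esssup_y H(Dw(y), y). -/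
def Hstar (d : ℕ) (H : Ed d → Ed d → ℝ) : ℝ :=
  sInf {t | ∃ w ∈ LipFuns d, t = essSup (fun y => H (gradient w y) y) volume}

/-- m_μ(y,x) = sup { w(y) − w(x) : w ∈ 𝓛, H(Dw,z) ≤ μ a.e. }. -/
def mMu (d : ℕ) (H : Ed d → Ed d → ℝ) (μ : ℝ) (y x : Ed d) : ℝ :=
  sSup {t | ∃ w ∈ LipFuns d, (∀ᵐ z ∂volume, H (gradient w z) z ≤ μ) ∧ t = w y - w x}

/-- Viscosity subsolution of F(Du, y) ≤ μ in U. -/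
def ViscSub (d : ℕ) (F : Ed d → Ed d → ℝ) (μ : ℝ) (U : Set (Ed d)) (u : Ed d → ℝ) : Prop :=
  ∀ (φ : Ed d → ℝ) (x₀ : Ed d), x₀ ∈ U → ContDiffAt ℝ 1 φ x₀ →
    IsLocalMaxOn (fun y => u y - φ y) U x₀ → F (gradient φ x₀) x₀ ≤ μ

/-- Viscosity supersolution of F(Dv, y) ≥ μ in U. -/
def ViscSuper (d : ℕ) (F : Ed d → Ed d → ℝ) (μ : ℝ) (U : Set (Ed d)) (v : Ed d → ℝ) : Prop :=
  ∀ (φ : Ed d → ℝ) (x₀ : Ed d), x₀ ∈ U → ContDiffAt ℝ 1 φ x₀ →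
    IsLocalMinOn (fun y => v y - φ y) U x₀ → μ ≤ F (gradient φ x₀) x₀ 

/-- ω-dependent H̄₊. -/
def HbarPlusOm (d : ℕ) {Ω : Type*} (H : Ed d → Ed d → Ω → ℝ) (p : Ed d) (ω : Ω) : ℝ :=
  sInf {t | ∃ w ∈ SLplus d, t = essSup (fun y => H (p + gradient w y) y ω) volume}

/-- ω-dependent H̄₋. -/
def HbarMinusOm (d : ℕ) {Ω : Type*} (H : Ed d → Ed d → Ω → ℝ) (p : Ed d) (ω : Ω) : ℝ :=
  sInf {t | ∃ w ∈ SLminus d, t = essSup (fun y => H (p + gradient w y) y ω) volume}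

/-- ω-dependent Ĥ. -/
def HhatOm (d : ℕ) {Ω : Type*} (H : Ed d → Ed d → Ω → ℝ) (p : Ed d) (ω : Ω) : ℝ :=
  sInf {t | ∃ w ∈ Scal d, t = essSup (fun y => H (p + gradient w y) y ω) volume}

/-- ω-dependent H̄*. -/
def HstarOm (d : ℕ) {Ω : Type*} (H : Ed d → Ed d → Ω → ℝ) (ω : Ω) : ℝ :=
  sInf {t | ∃ w ∈ LipFuns d, t = essSup (fun y => H (gradient w y) y ω) volume}

/-- ω-dependent metric problem solution m_μ(y,x,ω). -/
def mMuOm (d : ℕ) {Ω : Type*} (H : Ed d → Ed d → Ω → ℝ) (μ : ℝ) (y x : Ed d) (ω : Ω) : ℝ :=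
  sSup {t | ∃ w ∈ LipFuns d, (∀ᵐ z ∂volume, H (gradient w z) z ω ≤ μ) ∧ t = w y - w x}


/-! ### Deterministic part -/

lemma inner_gradient_eq {d : ℕ} (w : Ed d → ℝ) (x v : Ed d) :
    ⟪gradient w x, v⟫ = fderiv ℝ w x v := by
  simp [gradient]

lemma norm_gradient_le {d : ℕ} {w : Ed d → ℝ} {C : ℝ≥0} (hw : LipschitzWith C w) (x : Ed d) :
    ‖gradient w x‖ ≤ C := by
  have := norm_fderiv_le_of_lipschitz ℝ (x₀ := x) hw
  simpa [gradient] using this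

/-- A Lipschitz function whose gradient satisfies a one-sided bound a.e. on a ball. -/
lemma lip_increment_le {d : ℕ} {w : Ed d → ℝ} {C : ℝ≥0} (hw : LipschitzWith C w)
    (a v : Ed d) (r c : ℝ) (hv : ‖v‖ < r)
    (h : ∀ᵐ z ∂(volume : Measure (Ed d)), dist z a < r → fderiv ℝ w z v ≤ c) :
    w (a + v) - w a ≤ c := by
  by_contra hcon
  push Not at hcon
  set κ := w (a + v) - w a - c with hκ
  have hκ0 : 0 < κ := by linarith
  obtain ⟨ρ, hρ0, hρ1, hρ2⟩ : ∃ ρ : ℝ, 0 < ρ ∧ ‖v‖ + ρ < r ∧ 2 * C * ρ ≤ κ / 2 := by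
    refine ⟨min ((r - ‖v‖) / 2) (κ / (4 * (C + 1))), ?_, ?_, ?_⟩
    · have : 0 < κ / (4 * ((C : ℝ) + 1)) := by positivity
      exact lt_min (by linarith) this
    · have := min_le_left ((r - ‖v‖) / 2) (κ / (4 * ((C : ℝ) + 1)))
      linarith
    · have h1 := min_le_right ((r - ‖v‖) / 2) (κ / (4 * ((C : ℝ) + 1)))
      have hC : (0 : ℝ) ≤ C := C.2
      calc 2 * (C : ℝ) * min ((r - ‖v‖) / 2) (κ / (4 * ((C : ℝ) + 1)))
          ≤ 2 * C * (κ / (4 * ((C : ℝ) + 1))) := by gcongr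
        _ = (C / (C + 1)) * (κ / 2) := by field_simp; ring
        _ ≤ 1 * (κ / 2) := by
            gcongr
            rw [div_le_one (by positivity)]; linarith
        _ = κ / 2 := one_mul _
  set B := Metric.ball a ρ with hB
  have hBfin : volume B < ⊤ := measure_ball_lt_top
  have hBpos : 0 < volume B := Metric.measure_ball_pos _ _ hρ0
  set ν := (volume : Measure (Ed d)).restrict B with hν
  have : IsFiniteMeasure ν := ⟨by simpa [hν] using hBfin⟩
  have hcontw : Continuous w := hw.continuous
  have hInteg : ∀ t : ℝ, Integrable (fun x => w (x + t • v)) ν := by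
    intro t
    have : IntegrableOn (fun x => w (x + t • v)) (Metric.closedBall a ρ) volume :=
      (Continuous.continuousOn (by fun_prop)).integrableOn_compact (isCompact_closedBall a ρ)
    exact this.mono_set Metric.ball_subset_closedBall
  have hder : ∀ t : ℝ, Integrable (fun x => fderiv ℝ w (x + t • v) v) ν ∧
      HasDerivAt (fun t : ℝ => ∫ x, w (x + t • v) ∂ν) (∫ x, fderiv ℝ w (x + t • v) v ∂ν) t := by
    intro t
    refine hasDerivAt_integral_of_dominated_loc_of_lip (F := fun t x => w (x + t • v))
      (F' := fun x => fderiv ℝ w (x + t • v) v)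
      (bound := fun _ => C * ‖v‖) (s := Set.univ) univ_mem ?_ (hInteg t) ?_ ?_ ?_ ?_
    · exact Eventually.of_forall fun t => (hInteg t).aestronglyMeasurable
    · exact ((measurable_fderiv_apply_const ℝ w v).comp
        (measurable_add_const (t • v))).aestronglyMeasurable
    · refine Eventually.of_forall fun x => ?_
      refine LipschitzOnWith.of_dist_le_mul fun s _ s' _ => ?_
      have h1 := hw.dist_le_mul (x + s • v) (x + s' • v)
      have h2 : dist (x + s • v) (x + s' • v) = dist s s' * ‖v‖ := by
        rw [dist_add_left, dist_eq_norm, ← sub_smul, norm_smul, Real.dist_eq, Real.norm_eq_abs]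
      rw [h2] at h1
      refine h1.trans_eq ?_
      have : ((Real.nnabs (C * ‖v‖) : ℝ≥0) : ℝ) = C * ‖v‖ := by
        rw [Real.coe_nnabs, abs_of_nonneg (by positivity)]
      rw [this]; ring
    · exact integrable_const _
    · have h1 : ∀ᵐ x ∂(volume : Measure (Ed d)), DifferentiableAt ℝ w (x + t • v) :=
        (measurePreserving_add_right volume (t • v)).quasiMeasurePreserving.ae
          hw.ae_differentiableAt
      filter_upwards [ae_restrict_of_ae h1] with x hx
      have h2 : HasDerivAt (fun t : ℝ => x + t • v) v t := by
        simpa using ((hasDerivAt_id t).smul_const v).const_add x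
      exact hx.hasFDerivAt.comp_hasDerivAt t h2
  have hle : ∀ t ∈ Set.Icc (0 : ℝ) 1,
      ∫ x, fderiv ℝ w (x + t • v) v ∂ν ≤ ∫ _x, c ∂ν := by
    intro t ht
    refine integral_mono_ae (hder t).1 (integrable_const _) ?_
    have h1 := (measurePreserving_add_right (volume : Measure (Ed d)) (t • v)).quasiMeasurePreserving.ae h
    have h2 : ∀ᵐ x ∂ν, x ∈ B := ae_restrict_mem Metric.isOpen_ball.measurableSet
    filter_upwards [ae_restrict_of_ae h1, h2] with x hx hxB
    apply hx
    rw [hB, Metric.mem_ball] at hxB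
    calc dist (x + t • v) a ≤ dist (x + t • v) x + dist x a := dist_triangle _ _ _
      _ = ‖t • v‖ + dist x a := by simp [dist_eq_norm]
      _ ≤ ‖v‖ + dist x a := by
          rw [norm_smul, Real.norm_of_nonneg ht.1]
          have := mul_le_mul_of_nonneg_right ht.2 (norm_nonneg v)
          linarith
      _ < r := by linarith
  have hmv := Convex.image_sub_le_mul_sub_of_deriv_le (convex_Icc (0 : ℝ) 1)
    (f := fun t : ℝ => ∫ x, w (x + t • v) ∂ν)
    (fun t _ => (hder t).2.continuousAt.continuousWithinAt)
    (fun t _ => (hder t).2.differentiableAt.differentiableWithinAt)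
    (C := ∫ _x, c ∂ν)
    (fun t ht => by
      rw [(hder t).2.deriv]
      exact hle t (interior_subset ht))
    0 (by simp) 1 (by simp) zero_le_one
  have hlow : ∫ _x, (c + κ / 2) ∂ν ≤ ∫ x, (w (x + (1:ℝ) • v) - w (x + (0:ℝ) • v)) ∂ν := by
    refine integral_mono_ae (integrable_const _) ((hInteg 1).sub (hInteg 0)) ?_
    have h2 : ∀ᵐ x ∂ν, x ∈ B := ae_restrict_mem Metric.isOpen_ball.measurableSet
    filter_upwards [h2] with x hxB
    rw [hB, Metric.mem_ball] at hxB
    simp only [one_smul, zero_smul, add_zero]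
    have h3 := hw.dist_le_mul (x + v) (a + v)
    have h4 := hw.dist_le_mul x a
    rw [dist_add_right] at h3
    have h5 : (C : ℝ) * dist x a ≤ C * ρ := by gcongr
    rw [Real.dist_eq] at h3 h4
    have := abs_le.1 h3
    have := abs_le.1 h4
    linarith
  rw [integral_sub (hInteg 1) (hInteg 0)] at hlow
  simp only [integral_const, smul_eq_mul] at hlow hmv
  have hpos : 0 < ν.real Set.univ := by
    simp only [hν, measureReal_restrict_apply_univ]
    exact ENNReal.toReal_pos hBpos.ne' hBfin.ne
  nlinarith

/-- Integrated (pointwise-stable) form of the subsolution property. -/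
def SubSol {d : ℕ} (G : Ed d → Ed d → ℝ) (μ : ℝ) (w : Ed d → ℝ) : Prop :=
  ∀ (a b : Ed d) (r c : ℝ), dist b a < r →
    (∀ z, dist z a < r → ∀ p, G p z ≤ μ → ⟪p, b - a⟫ ≤ c) → w b - w a ≤ c

lemma subSol_of_ae {d : ℕ} {G : Ed d → Ed d → ℝ} {μ : ℝ} {w : Ed d → ℝ}
    (hw : w ∈ LipFuns d) (h : ∀ᵐ z ∂volume, G (gradient w z) z ≤ μ) : SubSol G μ w := by
  obtain ⟨C, hC⟩ := hw
  intro a b r c hr hc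
  have := lip_increment_le hC a (b - a) r c (by rwa [← dist_eq_norm]) (by
    filter_upwards [h] with z hz hza
    rw [← inner_gradient_eq]
    exact hc z hza _ hz)
  simpa using this

lemma SubSol.lip {d : ℕ} {G : Ed d → Ed d → ℝ} {μ : ℝ} {w : Ed d → ℝ} {R : ℝ}
    (hw : SubSol G μ w) (hR : ∀ p z, G p z ≤ μ → ‖p‖ ≤ R) (a b : Ed d) :
    w b - w a ≤ R * dist b a := by
  refine hw a b (dist b a + 1) _ (by linarith) fun z _ p hp => ?_
  calc ⟪p, b - a⟫ ≤ ‖p‖ * ‖b - a‖ := real_inner_le_norm _ _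
    _ ≤ R * dist b a := by
      rw [dist_eq_norm]; gcongr; exact hR p z hp

lemma SubSol.mem_lip {d : ℕ} {G : Ed d → Ed d → ℝ} {μ : ℝ} {w : Ed d → ℝ} {R : ℝ}
    (hw : SubSol G μ w) (hR0 : 0 ≤ R) (hR : ∀ p z, G p z ≤ μ → ‖p‖ ≤ R) :
    LipschitzWith ⟨R, hR0⟩ w := by
  refine LipschitzWith.of_dist_le_mul fun a b => ?_
  rw [Real.dist_eq, abs_le]
  have h1 := hw.lip hR a b
  have h2 := hw.lip hR b a
  rw [dist_comm] at h1
  constructor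
  · change -(R * dist a b) ≤ _
    linarith
  · exact h2

lemma convex_of_midpoint_closed {d : ℕ} {K : Set (Ed d)} (hK : IsClosed K)
    (hm : ∀ p ∈ K, ∀ q ∈ K, (1/2 : ℝ) • (p + q) ∈ K) : Convex ℝ K := by
  rw [convex_iff_segment_subset]
  intro p hp q hq
  by_contra hcon
  rw [Set.not_subset] at hcon
  obtain ⟨x, hx, hxK⟩ := hcon
  rw [segment_eq_image_lineMap] at hx
  obtain ⟨t, ht, rfl⟩ := hx
  -- the set of parameters is closed and midpoint convex
  let S : Set ℝ := {s | AffineMap.lineMap p q s ∈ K}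
  have hS : IsClosed S := hK.preimage AffineMap.lineMap_continuous
  have hSm : ∀ s ∈ S, ∀ s' ∈ S, (s + s') / 2 ∈ S := by
    intro s hs s' hs'
    have := hm _ hs _ hs'
    have he : AffineMap.lineMap p q ((s + s') / 2) =
        (1/2 : ℝ) • (AffineMap.lineMap p q s + AffineMap.lineMap p q s' : Ed d) := by
      simp only [AffineMap.lineMap_apply_module]
      module
    change AffineMap.lineMap p q ((s + s') / 2) ∈ K
    rw [he]; exact this
  have hS0 : (0 : ℝ) ∈ S := by simpa [S] using hp
  have hS1 : (1 : ℝ) ∈ S := by simpa [S] using hq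
  have htS : t ∉ S := hxK
  -- gap around t
  have hA : IsCompact (S ∩ Set.Icc 0 t) := isCompact_Icc.inter_left hS
  have hA' : IsCompact (S ∩ Set.Icc t 1) := isCompact_Icc.inter_left hS
  obtain ⟨l, hl, hlmax⟩ := hA.exists_isGreatest ⟨0, hS0, le_refl _, ht.1⟩
  obtain ⟨u, hu, humin⟩ := hA'.exists_isLeast ⟨1, hS1, ht.2, le_refl _⟩
  have hlt : l < t := lt_of_le_of_ne hl.2.2 fun h => htS (h ▸ hl.1)
  have hut : t < u := lt_of_le_of_ne hu.2.1 fun h => htS (h ▸ hu.1)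
  have hmid := hSm l hl.1 u hu.1
  rcases le_total ((l + u) / 2) t with h | h
  · have := hlmax ⟨hmid, by linarith [hl.2.1], h⟩
    linarith
  · have := humin ⟨hmid, h, by linarith [hu.2.2]⟩
    linarith

lemma ae_of_subSol {d : ℕ} {G : Ed d → Ed d → ℝ} {μ : ℝ} {w : Ed d → ℝ}
    (hcont : Continuous fun q : Ed d × Ed d => G q.1 q.2)
    (hqc : ∀ p q y : Ed d, G ((1/2 : ℝ) • (p + q)) y ≤ max (G p y) (G q y))
    (hUC : ∀ η : ℝ, 0 < η → ∃ δ : ℝ, 0 < δ ∧ ∀ p z z' : Ed d, dist z' z < δ →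
      G p z' ≤ μ → G p z ≤ μ + η)
    (hw : SubSol G μ w) {C : ℝ≥0} (hL : LipschitzWith C w) :
    ∀ᵐ z ∂volume, G (gradient w z) z ≤ μ := by
  filter_upwards [hL.ae_differentiableAt] with z hz
  by_contra hcon
  push Not at hcon
  set q := gradient w z with hq
  set η := (G q z - μ) / 2 with hη
  have hη0 : 0 < η := by linarith [hη]
  obtain ⟨δ, hδ, hδ'⟩ := hUC η hη0
  let K : Set (Ed d) := {p | G p z ≤ μ + η}
  have hKc : IsClosed K := isClosed_le (by fun_prop) continuous_const
  have hKconv : Convex ℝ K := convex_of_midpoint_closed hKc fun p hp q hq =>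
    (hqc p q z).trans (max_le hp hq)
  have hqK : q ∉ K := by
    intro h
    have h : G q z ≤ μ + η := h
    linarith
  obtain ⟨f, c, hfc, hcf⟩ := geometric_hahn_banach_closed_point hKconv hKc hqK
  set v := (InnerProductSpace.toDual ℝ (Ed d)).symm f with hv
  have hfv : ∀ p, f p = ⟪p, v⟫ := by
    intro p
    rw [real_inner_comm, hv, InnerProductSpace.toDual_symm_apply]
  -- difference quotients
  have hd : HasDerivAt (fun s : ℝ => w (z + s • v)) (fderiv ℝ w z v) 0 := by
    have h2 : HasDerivAt (fun s : ℝ => z + s • v) v 0 := by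
      simpa using ((hasDerivAt_id (0:ℝ)).smul_const v).const_add z
    have hz' : HasFDerivAt w (fderiv ℝ w z) (z + (0:ℝ) • v) := by simpa using hz.hasFDerivAt
    exact hz'.comp_hasDerivAt 0 h2
  have hle : fderiv ℝ w z v ≤ c := by
    have ht := hd.tendsto_slope_zero_right
    refine le_of_tendsto ht ?_
    have hsmall : ∀ᶠ s : ℝ in 𝓝[>] 0, s * ‖v‖ < δ := by
      have : Tendsto (fun s : ℝ => s * ‖v‖) (𝓝[>] 0) (𝓝 (0 * ‖v‖)) :=
        ((continuous_id.mul continuous_const).tendsto 0).mono_left nhdsWithin_le_nhds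
      rw [zero_mul] at this
      exact this.eventually (gt_mem_nhds hδ)
    filter_upwards [hsmall, self_mem_nhdsWithin] with s hs hs0
    have hs0 : 0 < s := hs0
    have := hw z (z + s • v) δ (s * c) (by
      rw [dist_eq_norm, add_sub_cancel_left, norm_smul, Real.norm_of_nonneg hs0.le]; exact hs)
      (fun z' hz' p hp => by
        have h1 : f p < c := hfc p (hδ' p z z' hz' hp)
        rw [hfv] at h1
        rw [add_sub_cancel_left, inner_smul_right]
        exact mul_le_mul_of_nonneg_left h1.le hs0.le)
    simp only [zero_add, zero_smul, add_zero, smul_eq_mul]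
    rw [inv_mul_le_iff₀ hs0]
    exact this
  rw [hfv, hq, inner_gradient_eq] at hcf
  linarith

/-- Standing facts on a frozen Hamiltonian at a level `μ` above the critical one. -/
structure GoodHam {d : ℕ} (G : Ed d → Ed d → ℝ) (μ R : ℝ) : Prop where
  cont : Continuous fun q : Ed d × Ed d => G q.1 q.2
  qc : ∀ p q y : Ed d, G ((1/2 : ℝ) • (p + q)) y ≤ max (G p y) (G q y)
  uc : ∀ η : ℝ, 0 < η → ∃ δ : ℝ, 0 < δ ∧ ∀ p z z' : Ed d, dist z' z < δ →
      G p z' ≤ μ → G p z ≤ μ + η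
  R0 : 0 ≤ R
  bd : ∀ p z, G p z ≤ μ → ‖p‖ ≤ R
  ne : ∃ w, SubSol G μ w
  approx : ∀ p z, G p z ≤ μ → ∀ ε : ℝ, 0 < ε → ∃ p', dist p' p < ε ∧ G p' z < μ

namespace GoodHam

variable {d : ℕ} {G : Ed d → Ed d → ℝ} {μ R : ℝ}

lemma iff_sub (hG : GoodHam G μ R) (w : Ed d → ℝ) :
    (w ∈ LipFuns d ∧ ∀ᵐ z ∂volume, G (gradient w z) z ≤ μ) ↔ SubSol G μ w := by
  constructor
  · rintro ⟨h1, h2⟩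
    exact subSol_of_ae h1 h2
  · intro h
    have hL := h.mem_lip hG.R0 hG.bd
    exact ⟨⟨_, hL⟩, ae_of_subSol hG.cont hG.qc hG.uc h hL⟩

lemma le_m (hG : GoodHam G μ R) {w : Ed d → ℝ} (hw : SubSol G μ w) (y x : Ed d) :
    w y - w x ≤ mMu d G μ y x := by
  refine le_csSup ⟨R * dist y x, ?_⟩ ?_
  · rintro t ⟨w, hw, hw', rfl⟩
    exact (subSol_of_ae hw hw').lip hG.bd x y
  · obtain ⟨h1, h2⟩ := (hG.iff_sub w).2 hw
    exact ⟨w, h1, h2, rfl⟩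

lemma m_le (hG : GoodHam G μ R) (y x : Ed d) {s : ℝ}
    (h : ∀ w, SubSol G μ w → w y - w x ≤ s) : mMu d G μ y x ≤ s := by
  refine csSup_le ?_ ?_
  · obtain ⟨w, hw⟩ := hG.ne
    obtain ⟨h1, h2⟩ := (hG.iff_sub w).2 hw
    exact ⟨_, w, h1, h2, rfl⟩
  · rintro t ⟨w, hw, hw', rfl⟩
    exact h w (subSol_of_ae hw hw')

lemma m_sub (hG : GoodHam G μ R) (x : Ed d) : SubSol G μ (fun y => mMu d G μ y x) := by
  intro a b r c hr hc
  have : mMu d G μ b x ≤ mMu d G μ a x + c := by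
    refine hG.m_le b x fun w hw => ?_
    have h1 := hw a b r c hr hc
    have h2 := hG.le_m hw a x
    linarith
  show mMu d G μ b x - mMu d G μ a x ≤ c
  linarith

lemma m_self (hG : GoodHam G μ R) (x : Ed d) : mMu d G μ x x = 0 := by
  refine le_antisymm (hG.m_le x x fun w _ => by simp) ?_
  obtain ⟨w, hw⟩ := hG.ne
  simpa using hG.le_m hw x x

lemma m_triangle (hG : GoodHam G μ R) (x y z : Ed d) :
    mMu d G μ z x ≤ mMu d G μ z y + mMu d G μ y x := by
  refine hG.m_le z x fun w hw => ?_
  have h1 := hG.le_m hw z y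
  have h2 := hG.le_m hw y x
  linarith

lemma m_lip (hG : GoodHam G μ R) (x y z : Ed d) :
    |mMu d G μ y x - mMu d G μ z x| ≤ R * dist y z := by
  have := ((hG.m_sub x).mem_lip hG.R0 hG.bd).dist_le_mul y z
  rwa [Real.dist_eq] at this

lemma step_le (hG : GoodHam G μ R) {e : ℕ → Ed d} (he : DenseRange e) {a b : Ed d} {r c : ℝ}
    (hr : dist b a < r)
    (h : ∀ k l, dist (e k) a < r → G (e l) (e k) < μ → ⟪e l, b - a⟫ ≤ c)
    {w : Ed d → ℝ} (hw : SubSol G μ w) : w b - w a ≤ c := by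
  have hcont := hG.cont
  have h1 : ∀ z p, dist z a < r → G p z < μ → ⟪p, b - a⟫ ≤ c := by
    intro z p hz hp
    by_contra hcon
    push Not at hcon
    let O : Set (Ed d × Ed d) := {q | (dist q.2 a < r ∧ G q.1 q.2 < μ) ∧ c < ⟪q.1, b - a⟫}
    have hO : IsOpen O := by
      refine IsOpen.inter (IsOpen.inter ?_ ?_) ?_
      · exact isOpen_lt (f := fun q : Ed d × Ed d => dist q.2 a) (by fun_prop) continuous_const
      · exact isOpen_lt hcont continuous_const
      · exact isOpen_lt (g := fun q : Ed d × Ed d => ⟪q.1, b - a⟫) continuous_const (by fun_prop)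
    obtain ⟨⟨l, k⟩, hlk⟩ := (he.prodMap he).exists_mem_open hO ⟨(p, z), ⟨hz, hp⟩, hcon⟩
    have := h k l hlk.1.1 hlk.1.2
    exact absurd hlk.2 (not_lt.2 this)
  refine hw a b r c hr fun z hz p hp => ?_
  refine le_of_forall_pos_le_add fun ε hε => ?_
  obtain ⟨p', hp', hp''⟩ := hG.approx p z hp (ε / (‖b - a‖ + 1)) (by positivity)
  have h2 := h1 z p' hz hp''
  have h3 : ⟪p, b - a⟫ = ⟪p', b - a⟫ + ⟪p - p', b - a⟫ := by
    rw [← inner_add_left]; simp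
  have h4 : ⟪p - p', b - a⟫ ≤ ε := by
    calc ⟪p - p', b - a⟫ ≤ ‖p - p'‖ * ‖b - a‖ := real_inner_le_norm _ _
      _ ≤ (ε / (‖b - a‖ + 1)) * (‖b - a‖ + 1) := by
        rw [dist_eq_norm, norm_sub_rev] at hp'
        gcongr
        linarith
      _ = ε := by field_simp
  linarith

end GoodHam

/-! ### Measurability of the metric problem -/

/-- The event that the frozen constraint between `e i` and `e j` holds with constant `c`. -/
def stepSet {d : ℕ} {Ω : Type*} (H : Ed d → Ed d → Ω → ℝ) (μ : ℝ) (e : ℕ → Ed d)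
    (i j : ℕ) (c : ℚ) : Set Ω :=
  ⋃ r : ℚ, {ω | dist (e j) (e i) < (r : ℝ) ∧ ∀ k l : ℕ, dist (e k) (e i) < (r : ℝ) →
    H (e l) (e k) ω < μ → ⟪e l, e j - e i⟫ ≤ (c : ℝ)}

/-- The event that `e j` is reached from `e 0` by a chain of `n` steps of total cost `q`. -/
def reachSet {d : ℕ} {Ω : Type*} (H : Ed d → Ed d → Ω → ℝ) (μ : ℝ) (e : ℕ → Ed d) :
    ℕ → ℕ → ℚ → Set Ω
  | 0, j, q => {_ω | j = 0 ∧ q = 0}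
  | n + 1, j, q => ⋃ i : ℕ, ⋃ c : ℚ, reachSet H μ e n i (q - c) ∩ stepSet H μ e i j c

section Meas
variable {d : ℕ} {Ω : Type*} {H : Ed d → Ed d → Ω → ℝ} {μ : ℝ} {e : ℕ → Ed d}

lemma measurableSet_stepSet [MeasurableSpace Ω] (hH : ∀ p z, Measurable (H p z)) (i j : ℕ) (c : ℚ) :
    MeasurableSet (stepSet H μ e i j c) := by
  refine MeasurableSet.iUnion fun r => ?_
  refine MeasurableSet.inter (MeasurableSet.const _) ?_
  refine MeasurableSet.congr (s := ⋂ k : ℕ, ⋂ l : ℕ, ⋂ _ : dist (e k) (e i) < (r : ℝ),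
    {ω | H (e l) (e k) ω < μ → ⟪e l, e j - e i⟫ ≤ (c : ℝ)}) ?_ (by
      ext ω
      simp only [Set.mem_iInter]
      rfl)
  refine MeasurableSet.iInter fun k => MeasurableSet.iInter fun l => MeasurableSet.iInter fun _ => ?_
  have : {ω | H (e l) (e k) ω < μ → ⟪e l, e j - e i⟫ ≤ (c : ℝ)} =
      {ω | H (e l) (e k) ω < μ}ᶜ ∪ {_ω | ⟪e l, e j - e i⟫ ≤ (c : ℝ)} := by
    ext ω
    simp only [Set.mem_ofPred_eq, Set.mem_union, Set.mem_compl_iff]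
    tauto
  rw [this]
  exact ((measurableSet_lt (hH _ _) measurable_const).compl).union (MeasurableSet.const _)

lemma measurableSet_reachSet [MeasurableSpace Ω] (hH : ∀ p z, Measurable (H p z)) (n : ℕ) :
    ∀ (j : ℕ) (q : ℚ), MeasurableSet (reachSet H μ e n j q) := by
  induction n with
  | zero => exact fun j q => MeasurableSet.const _
  | succ n ih =>
    exact fun j q => MeasurableSet.iUnion fun i => MeasurableSet.iUnion fun c =>
      (ih i _).inter (measurableSet_stepSet hH i j c)

lemma reach_le {R : ℝ} (he : DenseRange e) {ω : Ω} (hG : GoodHam (fun p z => H p z ω) μ R)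
    {w : Ed d → ℝ} (hw : SubSol (fun p z => H p z ω) μ w) (n : ℕ) :
    ∀ (j : ℕ) (q : ℚ), ω ∈ reachSet H μ e n j q → w (e j) - w (e 0) ≤ q := by
  induction n with
  | zero =>
    rintro j q ⟨rfl, rfl⟩
    simp
  | succ n ih =>
    intro j q h
    simp only [reachSet, Set.mem_iUnion] at h
    obtain ⟨i, c, h1, h2⟩ := h
    have h3 := ih i _ h1
    simp only [stepSet, Set.mem_iUnion] at h2
    obtain ⟨r, hr, h4⟩ := h2
    have h5 := hG.step_le he hr h4 hw
    push_cast at h3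
    linarith

lemma m_lt_iff {R : ℝ} (he : DenseRange e) {ω : Ω} (hG : GoodHam (fun p z => H p z ω) μ R)
    (j : ℕ) (s : ℝ) :
    mMuOm d H μ (e j) (e 0) ω < s ↔ ∃ n, ∃ q : ℚ, (q : ℝ) < s ∧ ω ∈ reachSet H μ e n j q := by
  set G : Ed d → Ed d → ℝ := fun p z => H p z ω with hGdef
  change mMu d G μ (e j) (e 0) < s ↔ _
  constructor
  swap
  · rintro ⟨n, q, hq, hr⟩
    exact lt_of_le_of_lt (hG.m_le _ _ fun w hw => reach_le he hG hw n j q hr) hq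
  intro hlt
  by_contra hcon
  push Not at hcon
  let Q : ℕ → Set ℝ := fun i => {t | ∃ n, ∃ q : ℚ, t = q ∧ ω ∈ reachSet H μ e n i q}
  let u : ℕ → ℝ := fun i => sInf (Q i)
  obtain ⟨w₀, hw₀⟩ := hG.ne
  have hbdd : ∀ i, BddBelow (Q i) := by
    intro i
    refine ⟨w₀ (e i) - w₀ (e 0), ?_⟩
    rintro t ⟨n, q, rfl, hq⟩
    exact reach_le he hG hw₀ n i q hq
  -- trivial steps
  have htriv : ∀ i k (c : ℚ), R * dist (e k) (e i) ≤ c → ω ∈ stepSet H μ e i k c := by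
    intro i k c hc
    obtain ⟨r, hr⟩ := exists_rat_gt (dist (e k) (e i))
    refine Set.mem_iUnion.2 ⟨r, hr, fun a b _ hb => ?_⟩
    refine le_trans ?_ hc
    calc ⟪e b, e k - e i⟫ ≤ ‖e b‖ * ‖e k - e i‖ := real_inner_le_norm _ _
      _ ≤ R * dist (e k) (e i) := by
        rw [dist_eq_norm]
        exact mul_le_mul_of_nonneg_right (hG.bd (e b) (e a) (le_of_lt hb)) (norm_nonneg _)
  have h00 : (0 : ℝ) ∈ Q 0 := ⟨0, 0, by simp, by simp [reachSet]⟩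
  have hstep : ∀ i k (c : ℚ), ω ∈ stepSet H μ e i k c → ∀ t ∈ Q i, t + c ∈ Q k := by
    rintro i k c hc t ⟨n, q, rfl, hq⟩
    refine ⟨n + 1, q + c, by push_cast; rfl, ?_⟩
    simp only [reachSet, Set.mem_iUnion]
    exact ⟨i, c, by simpa using hq, hc⟩
  have hne : ∀ i, (Q i).Nonempty := by
    intro i
    obtain ⟨c, hc⟩ := exists_rat_gt (R * dist (e i) (e 0))
    exact ⟨_, hstep 0 i c (htriv 0 i c hc.le) 0 h00⟩
  have hu : ∀ i k (c : ℚ), ω ∈ stepSet H μ e i k c → u k ≤ u i + c := by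
    intro i k c hc
    have : u k - c ≤ u i := by
      refine le_csInf (hne i) fun t ht => ?_
      have := csInf_le (hbdd k) (hstep i k c hc t ht)
      change u k ≤ _ at this
      linarith
    linarith
  have hulip : ∀ i k, u k ≤ u i + R * dist (e k) (e i) := by
    intro i k
    refine le_of_forall_pos_le_add fun ε hε => ?_
    obtain ⟨c, hc, hc'⟩ := exists_rat_btwn (lt_add_of_pos_right (R * dist (e k) (e i)) hε)
    have := hu i k c (htriv i k c hc.le)
    linarith
  let W : Ed d → ℝ := fun x => ⨅ i, (u i + R * dist x (e i))
  have hWbdd : ∀ x, BddBelow (Set.range fun i => u i + R * dist x (e i)) := by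
    intro x
    refine ⟨u 0 - R * dist x (e 0), ?_⟩
    rintro _ ⟨i, rfl⟩
    have h1 := hulip i 0
    have h2 : R * dist (e 0) (e i) ≤ R * (dist x (e 0) + dist x (e i)) :=
      mul_le_mul_of_nonneg_left (dist_triangle_left _ _ _) hG.R0
    simp only
    linarith
  have hWe : ∀ i, W (e i) = u i := by
    intro i
    refine le_antisymm ?_ (le_ciInf fun k => hulip k i)
    have := ciInf_le (hWbdd (e i)) i
    simpa using this
  have hWlip : ∀ x y, W x ≤ W y + R * dist x y := by
    intro x y
    have : W x - R * dist x y ≤ W y := by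
      refine le_ciInf fun i => ?_
      have h1 := ciInf_le (hWbdd x) i
      have h2 : R * dist x (e i) ≤ R * (dist x y + dist y (e i)) :=
        mul_le_mul_of_nonneg_left (dist_triangle _ _ _) hG.R0
      change W x ≤ _ at h1
      linarith
    linarith
  have hWsub : SubSol G μ W := by
    intro a b r c hr hc
    refine le_of_forall_pos_le_add fun ε hε => ?_
    have hR0 := hG.R0
    set η : ℝ := min (ε / (4 * R + 4)) ((r - dist b a) / 4) with hη
    have hη0 : 0 < η := lt_min (by positivity) (by linarith)
    have hη1 : (4 * R + 4) * η ≤ ε := by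
      have := min_le_left (ε / (4 * R + 4)) ((r - dist b a) / 4)
      rw [← hη, le_div_iff₀ (by positivity)] at this
      linarith
    have hη2 : 4 * η ≤ r - dist b a := by
      have := min_le_right (ε / (4 * R + 4)) ((r - dist b a) / 4)
      rw [← hη] at this
      linarith
    obtain ⟨i, hi⟩ := he.exists_dist_lt a hη0
    obtain ⟨k, hk⟩ := he.exists_dist_lt b hη0
    obtain ⟨c', hc1, hc2⟩ := exists_rat_btwn
      (show c + 2 * R * η < c + 2 * R * η + η by linarith)
    obtain ⟨r', hr1, hr2⟩ := exists_rat_btwn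
      (show dist b a + 2 * η < dist b a + 3 * η by linarith)
    have hs : ω ∈ stepSet H μ e i k c' := by
      refine Set.mem_iUnion.2 ⟨r', ?_, fun z p hz hp => ?_⟩
      · have h1 := dist_triangle4 (e k) b a (e i)
        rw [dist_comm (e k) b] at h1
        linarith
      · have hza : dist (e z) a < r := by
          have h1 := dist_triangle (e z) (e i) a
          rw [dist_comm (e i) a] at h1
          linarith
        have h1 := hc (e z) hza (e p) (le_of_lt hp)
        have hpR := hG.bd (e p) (e z) (le_of_lt hp)
        have h2 : ⟪e p, e k - e i⟫ = ⟪e p, b - a⟫ + ⟪e p, (e k - b) - (e i - a)⟫ := by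
          rw [← inner_add_right]; congr 1; abel
        have h3 : ⟪e p, (e k - b) - (e i - a)⟫ ≤ R * (2 * η) := by
          refine (real_inner_le_norm _ _).trans ?_
          have h4 : ‖(e k - b) - (e i - a)‖ ≤ 2 * η := by
            refine (norm_sub_le _ _).trans ?_
            rw [← dist_eq_norm, ← dist_eq_norm, dist_comm, dist_comm (e i)]
            linarith
          gcongr
        linarith
    have h1 := hu i k c' hs
    rw [← hWe, ← hWe] at h1
    have h2 := hWlip b (e k)
    have h3 := hWlip (e i) a
    rw [dist_comm (e i)] at h3
    have h4 : R * dist b (e k) ≤ R * η := by gcongr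
    have h5 : R * dist a (e i) ≤ R * η := by gcongr
    linarith
  have h1 := hG.le_m hWsub (e j) (e 0)
  rw [hWe, hWe] at h1
  have h2 : u 0 ≤ 0 := csInf_le (hbdd 0) h00
  have h3 : s ≤ u j := by
    refine le_csInf (hne j) ?_
    rintro t ⟨n, q, rfl, hq⟩
    by_contra hlt
    push Not at hlt
    exact hcon n q hlt hq
  linarith

lemma aemeasurable_m [MeasurableSpace Ω] {R : ℝ} {P : Measure Ω} (hH : ∀ p z, Measurable (H p z))
    (hgood : ∀ᵐ ω ∂P, GoodHam (fun p z => H p z ω) μ R) (y : Ed d) :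
    AEMeasurable (fun ω => mMuOm d H μ y 0 ω) P := by
  let e : ℕ → Ed d := fun n => match n with
    | 0 => 0
    | 1 => y
    | n + 2 => TopologicalSpace.denseSeq (Ed d) n
  have he : DenseRange e := by
    refine (TopologicalSpace.denseRange_denseSeq (Ed d)).mono ?_
    rintro _ ⟨n, rfl⟩
    exact ⟨n + 2, rfl⟩
  apply NullMeasurable.aemeasurable
  refine fun S hS => ?_
  revert S
  suffices h : @Measurable _ _ (NullMeasurableSpace.instMeasurableSpace (μ := P) (α := Ω)) _ (fun ω => mMuOm d H μ y 0 ω) from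
    fun S hS => h hS
  refine @measurable_of_Iio ℝ Ω _ _ _ (NullMeasurableSpace.instMeasurableSpace (μ := P) (α := Ω))
    _ _ _ _ ?_
  intro s
  change NullMeasurableSet ((fun ω => mMuOm d H μ y 0 ω) ⁻¹' Set.Iio s) P
  have hm : MeasurableSet (⋃ n : ℕ, ⋃ q : ℚ, ⋃ _ : (q : ℝ) < s, reachSet H μ e n 1 q) :=
    MeasurableSet.iUnion fun n => MeasurableSet.iUnion fun q => MeasurableSet.iUnion fun _ =>
      measurableSet_reachSet hH n 1 q
  refine hm.nullMeasurableSet.congr ?_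
  filter_upwards [hgood] with ω hω
  have := m_lt_iff he hω 1 s
  apply propext
  change ω ∈ (⋃ n : ℕ, ⋃ q : ℚ, ⋃ _ : (q : ℝ) < s, reachSet H μ e n 1 q) ↔ mMuOm d H μ y 0 ω < s
  refine Iff.trans ?_ this.symm
  simp only [Set.mem_iUnion, exists_prop]

end Meas

/-! ### Essential suprema -/

lemma essSup_le_iff_ae {d : ℕ} {f : Ed d → ℝ} {M : ℝ} (hM : ∀ y, |f y| ≤ M) (t : ℝ) :
    essSup f volume ≤ t ↔ ∀ᵐ y ∂(volume : Measure (Ed d)), f y ≤ t := by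
  have hb : IsBoundedUnder (· ≤ ·) (ae (volume : Measure (Ed d))) f :=
    isBoundedUnder_of ⟨M, fun y => (abs_le.1 (hM y)).2⟩
  have hb' : IsBoundedUnder (· ≥ ·) (ae (volume : Measure (Ed d))) f :=
    isBoundedUnder_of ⟨-M, fun y => (abs_le.1 (hM y)).1⟩
  constructor
  · intro h
    filter_upwards [ae_le_essSup hb] with y hy using hy.trans h
  · intro h
    exact essSup_le_of_ae_le t h hb'.isCoboundedUnder_le

lemma le_essSup_of_bound {d : ℕ} {f : Ed d → ℝ} {M c : ℝ} (hM : ∀ y, |f y| ≤ M)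
    (hc : ∀ y, c ≤ f y) : c ≤ essSup f volume := by
  have h := (essSup_le_iff_ae hM (essSup f volume)).1 le_rfl
  obtain ⟨y, hy⟩ := h.exists
  exact (hc y).trans hy

lemma zero_mem_LipFuns {d : ℕ} : (fun _ => 0 : Ed d → ℝ) ∈ LipFuns d := ⟨0, LipschitzWith.const 0⟩

lemma zero_mem_SLplus {d : ℕ} : (fun _ => 0 : Ed d → ℝ) ∈ SLplus d :=
  ⟨⟨0, LipschitzWith.const 0⟩, fun ε hε => ⟨0, fun y _ => by simp; linarith⟩⟩

lemma bound_comp {d : ℕ} {G : Ed d → Ed d → ℝ}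
    (hb : ∀ R : ℝ, 0 < R → ∃ M : ℝ, ∀ p y : Ed d, ‖p‖ ≤ R → |G p y| ≤ M)
    (p : Ed d) {w : Ed d → ℝ} (hw : w ∈ LipFuns d) :
    ∃ M, ∀ y, |G (p + gradient w y) y| ≤ M := by
  obtain ⟨C, hC⟩ := hw
  obtain ⟨M, hM⟩ := hb (‖p‖ + C + 1) (by positivity)
  refine ⟨M, fun y => hM _ _ ?_⟩
  have := norm_add_le p (gradient w y)
  have := norm_gradient_le hC y
  linarith

lemma exists_of_Hstar_lt {d : ℕ} {G : Ed d → Ed d → ℝ}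
    (hb : ∀ R : ℝ, 0 < R → ∃ M : ℝ, ∀ p y : Ed d, ‖p‖ ≤ R → |G p y| ≤ M)
    {t : ℝ} (h : Hstar d G < t) :
    ∃ w ∈ LipFuns d, ∀ᵐ y ∂volume, G (gradient w y) y ≤ t := by
  have hne : {t | ∃ w ∈ LipFuns d,
      t = essSup (fun y => G (gradient w y) y) volume}.Nonempty :=
    ⟨_, _, zero_mem_LipFuns, rfl⟩
  obtain ⟨s, ⟨w, hw, rfl⟩, hs⟩ := exists_lt_of_csInf_lt hne h
  obtain ⟨M, hM⟩ := bound_comp hb 0 hw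
  simp only [zero_add] at hM
  exact ⟨w, hw, (essSup_le_iff_ae hM t).1 hs.le⟩

lemma exists_of_HbarPlus_lt {d : ℕ} {G : Ed d → Ed d → ℝ}
    (hb : ∀ R : ℝ, 0 < R → ∃ M : ℝ, ∀ p y : Ed d, ‖p‖ ≤ R → |G p y| ≤ M)
    {p : Ed d} {t : ℝ} (h : HbarPlus d G p < t) :
    ∃ w ∈ SLplus d, ∀ᵐ y ∂volume, G (p + gradient w y) y ≤ t := by
  have hne : {t | ∃ w ∈ SLplus d,
      t = essSup (fun y => G (p + gradient w y) y) volume}.Nonempty :=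
    ⟨_, _, zero_mem_SLplus, rfl⟩
  obtain ⟨s, ⟨w, hw, rfl⟩, hs⟩ := exists_lt_of_csInf_lt hne h
  obtain ⟨M, hM⟩ := bound_comp hb p hw.1
  exact ⟨w, hw, (essSup_le_iff_ae hM t).1 hs.le⟩

lemma HbarPlus_le {d : ℕ} {G : Ed d → Ed d → ℝ}
    (hb : ∀ R : ℝ, 0 < R → ∃ M : ℝ, ∀ p y : Ed d, ‖p‖ ≤ R → |G p y| ≤ M)
    {c : ℝ} (hc : ∀ p y, c ≤ G p y) {p : Ed d} {t : ℝ} {w : Ed d → ℝ}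
    (hw : w ∈ SLplus d) (h : ∀ᵐ y ∂volume, G (p + gradient w y) y ≤ t) :
    HbarPlus d G p ≤ t := by
  obtain ⟨M, hM⟩ := bound_comp hb p hw.1
  have hbdd : BddBelow {t | ∃ w ∈ SLplus d,
      t = essSup (fun y => G (p + gradient w y) y) volume} := by
    refine ⟨c, ?_⟩
    rintro s ⟨w, hw, rfl⟩
    obtain ⟨M, hM⟩ := bound_comp hb p hw.1
    exact le_essSup_of_bound hM fun y => hc _ _
  exact (csInf_le hbdd ⟨w, hw, rfl⟩).trans ((essSup_le_iff_ae hM t).2 h)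

lemma gradient_add_inner {d : ℕ} {w : Ed d → ℝ} {z : Ed d} (p : Ed d)
    (hw : DifferentiableAt ℝ w z) :
    gradient (fun x => ⟪p, x⟫ + w x) z = p + gradient w z := by
  have h1 : HasFDerivAt (fun x : Ed d => ⟪p, x⟫) (innerSL ℝ p) z := (innerSL ℝ p).hasFDerivAt
  have h2 : fderiv ℝ (fun x => ⟪p, x⟫ + w x) z = innerSL ℝ p + fderiv ℝ w z :=
    (h1.add hw.hasFDerivAt).fderiv
  refine ext_inner_right ℝ fun v => ?_
  rw [inner_gradient_eq, h2, inner_add_left, inner_gradient_eq]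
  simp

lemma gradient_mid {d : ℕ} {w w' : Ed d → ℝ} {z : Ed d}
    (hw : DifferentiableAt ℝ w z) (hw' : DifferentiableAt ℝ w' z) :
    gradient (fun x => (1/2 : ℝ) * (w x + w' x)) z
      = (1/2 : ℝ) • (gradient w z + gradient w' z) := by
  have h2 : fderiv ℝ (fun x => (1/2 : ℝ) * (w x + w' x)) z
      = (1/2 : ℝ) • (fderiv ℝ w z + fderiv ℝ w' z) :=
    ((hw.hasFDerivAt.add hw'.hasFDerivAt).const_mul (1/2 : ℝ)).fderiv
  refine ext_inner_right ℝ fun v => ?_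
  rw [inner_gradient_eq, h2, inner_smul_left, inner_add_left, inner_gradient_eq, inner_gradient_eq]
  simp [mul_add]

lemma inner_add_mem_Lip {d : ℕ} (p : Ed d) {w : Ed d → ℝ} (hw : w ∈ LipFuns d) :
    (fun x => ⟪p, x⟫ + w x) ∈ LipFuns d := by
  obtain ⟨C, hC⟩ := hw
  exact ⟨_, (innerSL ℝ p).lipschitz.add hC⟩

lemma mid_mem_SLplus {d : ℕ} {w w' : Ed d → ℝ} (hw : w ∈ SLplus d) (hw' : w' ∈ SLplus d) :
    (fun x => (1/2 : ℝ) * (w x + w' x)) ∈ SLplus d := by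
  obtain ⟨⟨C, hC⟩, h⟩ := hw
  obtain ⟨⟨C', hC'⟩, h'⟩ := hw'
  refine ⟨⟨_, (lipschitzWith_smul (1/2 : ℝ)).comp (hC.add hC')⟩, fun ε hε => ?_⟩
  obtain ⟨r, hr⟩ := h ε hε
  obtain ⟨r', hr'⟩ := h' ε hε
  refine ⟨max r r', fun y hy => ?_⟩
  have h1 := hr y ((le_max_left _ _).trans hy)
  have h2 := hr' y ((le_max_right _ _).trans hy)
  have : (1/2 : ℝ) * (w y + w' y) / ‖y‖ = (w y / ‖y‖ + w' y / ‖y‖) / 2 := by ring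
  rw [this]; linarith

/-- Strict level-set convexity gives approximation of sublevel sets by strict ones. -/
lemma approx_of_strict {d : ℕ} {F : Ed d → ℝ} {μ : ℝ} {p q : Ed d}
    (hstep : ∀ q', F q' < μ → F ((1/2 : ℝ) • (p + q')) < μ) (hq : F q < μ) :
    ∃ s : ℕ → Ed d, (∀ n, F (s n) < μ) ∧ Tendsto s atTop (𝓝 p) := by
  refine ⟨fun n => p + ((1/2 : ℝ) ^ n) • (q - p), fun n => ?_, ?_⟩
  · induction n with
    | zero => simpa using hq
    | succ n ih =>
      have := hstep _ ih
      convert this using 2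
      simp only [pow_succ]
      module
  · have h1 : Tendsto (fun n : ℕ => (1/2 : ℝ) ^ n) atTop (𝓝 0) :=
      tendsto_pow_atTop_nhds_zero_of_lt_one (by norm_num) (by norm_num)
    have h2 := (h1.smul_const (q - p)).const_add p
    simpa using h2

/-- Uniform lower bound along all directions from convergence along a dense set of directions. -/
lemma uniform_lower {d : ℕ} {m N : Ed d → ℝ} {R : ℝ} (hR : 0 ≤ R)
    (hm : ∀ x y, |m x - m y| ≤ R * dist x y) (hN : ∀ x y, |N x - N y| ≤ R * dist x y)
    (hhom : ∀ c : ℝ, 0 < c → ∀ x, N (c • x) = c * N x)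
    {e : ℕ → Ed d} (he : DenseRange e)
    (hlim : ∀ n, Tendsto (fun t : ℝ => t⁻¹ * m (t • e n)) atTop (𝓝 (N (e n))))
    (ε : ℝ) (hε : 0 < ε) : ∃ r : ℝ, 0 < r ∧ ∀ z, r ≤ ‖z‖ → N z - ε * ‖z‖ ≤ m z := by
  set η := ε / (2 * R + 1) with hη
  have hη0 : 0 < η := by positivity
  have hcov : Metric.sphere (0 : Ed d) 1 ⊆ ⋃ n, Metric.ball (e n) η := by
    intro x _
    obtain ⟨n, hn⟩ := he.exists_dist_lt x hη0
    exact Set.mem_iUnion.2 ⟨n, hn⟩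
  obtain ⟨S, hS⟩ := (isCompact_sphere (0 : Ed d) 1).elim_finite_subcover _
    (fun n => Metric.isOpen_ball) hcov
  have hev : ∀ᶠ t : ℝ in atTop, ∀ n ∈ S, N (e n) - η < t⁻¹ * m (t • e n) := by
    rw [Filter.eventually_all_finset]
    intro n _
    exact (hlim n).eventually (lt_mem_nhds (by linarith))
  obtain ⟨r, hr⟩ := Filter.eventually_atTop.1 hev
  refine ⟨max r 1, by positivity, fun z hz => ?_⟩
  have hz0 : 0 < ‖z‖ := lt_of_lt_of_le one_pos ((le_max_right _ _).trans hz)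
  set t := ‖z‖ with ht
  set x := t⁻¹ • z with hx
  have hzx : z = t • x := by rw [hx, smul_smul, mul_inv_cancel₀ hz0.ne', one_smul]
  have hxs : x ∈ Metric.sphere (0 : Ed d) 1 := by
    rw [mem_sphere_zero_iff_norm, hx, norm_smul, norm_inv, Real.norm_of_nonneg hz0.le, ← ht,
      inv_mul_cancel₀ hz0.ne']
  obtain ⟨n, hnS, hn⟩ := Set.mem_iUnion₂.1 (hS hxs)
  rw [Metric.mem_ball] at hn
  have h1 := hr t ((le_max_left _ _).trans hz) n hnS
  have h2 := (abs_le.1 (hm z (t • e n))).1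
  have h3 := (abs_le.1 (hN x (e n))).2
  have hd : dist z (t • e n) = t * dist x (e n) := by
    rw [hzx, dist_smul₀, Real.norm_of_nonneg hz0.le]
  rw [hd] at h2
  have h4 : N z = t * N x := by rw [hzx, hhom t hz0]
  rw [inv_mul_eq_div, lt_div_iff₀ hz0] at h1
  have h5 : R * (t * dist x (e n)) ≤ R * (t * η) := by gcongr
  have h6 : t * N x ≤ t * (N (e n) + R * η) := by
    have : R * dist x (e n) ≤ R * η := by gcongr
    gcongr
    linarith
  have h7 : ε * t = (2 * R + 1) * η * t := by rw [hη]; field_simp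
  rw [h4, h7]
  nlinarith

/-- Hahn–Banach: a finite sublinear function is attained by a dominated linear form. -/
lemma exists_dominated {d : ℕ} (hd : 0 < d) {N : Ed d → ℝ}
    (hhom : ∀ c : ℝ, 0 < c → ∀ x, N (c • x) = c * N x)
    (hadd : ∀ x y, N (x + y) ≤ N x + N y) (h0 : N 0 = 0) (y : Ed d) :
    ∃ p : Ed d, (∀ x, ⟪p, x⟫ ≤ N x) ∧ ⟪p, y⟫ = N y := by
  have key : ∀ y : Ed d, y ≠ 0 → ∃ p : Ed d, (∀ x, ⟪p, x⟫ ≤ N x) ∧ ⟪p, y⟫ = N y := by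
    intro y hy
    let f : Ed d →ₗ.[ℝ] ℝ := LinearPMap.mkSpanSingleton y (N y) hy
    obtain ⟨g, hg1, hg2⟩ := exists_extension_of_le_sublinear f N hhom hadd (by
      rintro ⟨x, hx⟩
      obtain ⟨c, rfl⟩ := Submodule.mem_span_singleton.1 hx
      have : f ⟨c • y, hx⟩ = c * N y := by
        exact LinearPMap.mkSpanSingleton'_apply y (N y) _ c hx
      rw [this]
      rcases lt_trichotomy c 0 with hc | hc | hc
      · have h1 := hhom (-c) (by linarith) y
        have h2 := hadd (c • y) ((-c) • y)
        rw [← add_smul, add_neg_cancel, zero_smul, h0, h1] at h2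
        linarith
      · simp [hc, h0]
      · exact (hhom c hc y).ge)
    have hgy : g y = N y := by
      have h1 := hg1 ⟨y, Submodule.mem_span_singleton_self y⟩
      refine h1.trans ?_
      exact LinearPMap.mkSpanSingleton_apply ℝ ℝ hy (N y)
    refine ⟨(InnerProductSpace.toDual ℝ (Ed d)).symm (LinearMap.toContinuousLinearMap g),
      fun x => ?_, ?_⟩
    · rw [InnerProductSpace.toDual_symm_apply]; exact hg2 x
    · rw [InnerProductSpace.toDual_symm_apply]; exact hgy
  by_cases hy : y = 0
  · obtain ⟨p, hp, -⟩ := key (EuclideanSpace.single ⟨0, hd⟩ (1 : ℝ)) (by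
      intro h
      have := congrArg (fun v : Ed d => v ⟨0, hd⟩) h
      simp at this)
    exact ⟨p, hp, by simp [hy, h0]⟩
  · exact key y hy

lemma goodHam_of {d : ℕ} {G : Ed d → Ed d → ℝ} {μ R ν : ℝ} (hν : ν < μ) (hR0 : 0 ≤ R)
    (hcont : Continuous fun q : Ed d × Ed d => G q.1 q.2)
    (hqc : ∀ p q y : Ed d, G ((1/2 : ℝ) • (p + q)) y ≤ max (G p y) (G q y))
    (hR : ∀ p z, G p z ≤ μ → ‖p‖ ≤ R)
    (huc : ∀ R : ℝ, 0 < R → ∀ ε : ℝ, 0 < ε → ∃ δ : ℝ, 0 < δ ∧ ∀ (p p' y y' : Ed d),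
      ‖p‖ ≤ R → ‖p'‖ ≤ R → ‖p - p'‖ < δ → ‖y - y'‖ < δ → |G p y - G p' y'| < ε)
    (Λ : ℝ → ℝ → ℝ)
    (hΛmono : ∀ a b a' b' : ℝ, a ≤ a' → b ≤ b' → Λ a b ≤ Λ a' b')
    (hΛstrict : ∀ a b : ℝ, a ≠ b → Λ a b < max a b)
    (hsqc : ∀ (p q y : Ed d), G ((1/2 : ℝ) • (p + q)) y ≤ Λ (G p y) (G q y))
    (hex : ∃ w ∈ LipFuns d, ∀ᵐ y ∂volume, G (gradient w y) y ≤ ν) : GoodHam G μ R := by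
  obtain ⟨w, hw, hwν⟩ := hex
  have huc' : ∀ η : ℝ, 0 < η → ∃ δ : ℝ, 0 < δ ∧ ∀ p z z' : Ed d, dist z' z < δ →
      G p z' ≤ μ → G p z ≤ G p z' + η := by
    intro η hη
    obtain ⟨δ, hδ, h⟩ := huc (R + 1) (by linarith) η hη
    refine ⟨δ, hδ, fun p z z' hz hp => ?_⟩
    have hpR : ‖p‖ ≤ R + 1 := by linarith [hR p z' hp]
    have := abs_lt.1 (h p p z' z hpR hpR (by simpa using hδ) (by rwa [← dist_eq_norm]))
    linarith
  refine ⟨hcont, hqc, ?_, hR0, hR, ⟨w, subSol_of_ae hw ?_⟩, ?_⟩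
  · intro η hη
    obtain ⟨δ, hδ, h⟩ := huc' η hη
    exact ⟨δ, hδ, fun p z z' hz hp => (h p z z' hz hp).trans (by linarith)⟩
  · filter_upwards [hwν] with y hy using hy.trans hν.le
  · intro p z hp ε hε
    obtain ⟨δ, hδ, h⟩ := huc' ((μ - ν) / 2) (by linarith)
    have hdense : Dense {y | G (gradient w y) y ≤ ν} := Measure.dense_of_ae hwν
    obtain ⟨z', hz', hz'd⟩ := hdense.exists_dist_lt z hδ
    have hz' : G (gradient w z') z' ≤ ν := hz'
    rw [dist_comm] at hz'd
    have hq := h (gradient w z') z z' hz'd (hz'.trans hν.le)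
    obtain ⟨s, hs, hst⟩ := approx_of_strict (F := fun p => G p z) (p := p) (μ := μ)
      (q := gradient w z') (fun q' hq' => by
        have h1 := (hsqc p q' z).trans (hΛmono _ _ μ _ hp le_rfl)
        have h2 := hΛstrict μ (G q' z) (ne_of_gt hq')
        rw [max_eq_left (le_of_lt hq')] at h2
        exact h1.trans_lt h2) (show G (gradient w z') z < μ by linarith)
    obtain ⟨n, hn⟩ := ((Metric.tendsto_nhds.1 hst) ε hε).exists
    exact ⟨s n, hn, hs n⟩

lemma m_shift_le {d : ℕ} {Ω : Type*} {H : Ed d → Ed d → Ω → ℝ} {τ : Ed d → Ω → Ω} {μ R : ℝ}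
    (hHstat : ∀ (p y z : Ed d) (ω : Ω), H p y (τ z ω) = H p (y + z) ω)
    {ω : Ω} (z : Ed d) (hG : GoodHam (fun p z => H p z ω) μ R)
    (hG' : GoodHam (fun p y => H p y (τ z ω)) μ R) (y : Ed d) :
    mMuOm d H μ (z + y) z ω ≤ mMuOm d H μ y 0 (τ z ω) := by
  refine hG.m_le (z + y) z fun w hw => ?_
  have hsub : SubSol (fun p y => H p y (τ z ω)) μ (fun x => w (x + z)) := by
    intro a b r c hr hc
    refine hw (a + z) (b + z) r c (by simpa using hr) fun x hx p hp => ?_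
    have := hc (x - z) (by
      rw [dist_eq_norm] at hx ⊢
      convert hx using 2
      abel) p (by
      show H p (x - z) (τ z ω) ≤ μ
      rw [hHstat]; simpa using hp)
    simpa using this
  have := hG'.le_m hsub y 0
  simp only [zero_add] at this
  rw [add_comm y z] at this
  exact this

/-- duality between m̄_μ and the sublevel sets of H̄₊. -/
theorem statement_14
    (d : ℕ) (hd : 0 < d)
    {Ω : Type*} [MeasurableSpace Ω] (P : Measure Ω) [IsProbabilityMeasure P]
    (τ : Ed d → Ω → Ω)
    (hτmeas : ∀ y : Ed d, Measurable (τ y))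
    (hτmp : ∀ y : Ed d, MeasurePreserving (τ y) P P)
    (hτgrp : ∀ x y : Ed d, τ (x + y) = τ x ∘ τ y)
    (hτzero : τ 0 = id)
    (hτerg : ∀ A : Set Ω, MeasurableSet A → (∀ z : Ed d, τ z ⁻¹' A = A) → P A = 0 ∨ P A = 1)
    (H : Ed d → Ed d → Ω → ℝ)
    (hHmeas : Measurable fun x : Ed d × Ed d × Ω => H x.1 x.2.1 x.2.2)
    (hHstat : ∀ (p y z : Ed d) (ω : Ω), H p y (τ z ω) = H p (y + z) ω)
    (hHcont : ∀ ω : Ω, Continuous fun q : Ed d × Ed d => H q.1 q.2 ω)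
    (hreg_bdd : ∀ R : ℝ, 0 < R → ∃ M : ℝ, ∀ (ω : Ω) (p y : Ed d), ‖p‖ ≤ R → |H p y ω| ≤ M)
    (hreg_uc : ∀ R : ℝ, 0 < R → ∀ ε : ℝ, 0 < ε → ∃ δ : ℝ, 0 < δ ∧ ∀ (ω : Ω) (p p' y y' : Ed d),
      ‖p‖ ≤ R → ‖p'‖ ≤ R → ‖p - p'‖ < δ → ‖y - y'‖ < δ → |H p y ω - H p' y' ω| < ε)
    (hcoer : ∀ M : ℝ, ∃ R : ℝ, ∀ (ω : Ω) (p y : Ed d), R ≤ ‖p‖ → M ≤ H p y ω)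
    (hqc : ∀ (ω : Ω) (p q y : Ed d), H ((1/2 : ℝ) • (p + q)) y ω ≤ max (H p y ω) (H q y ω))
    (Λ : ℝ → ℝ → ℝ)
    (hΛcont : Continuous fun m : ℝ × ℝ => Λ m.1 m.2)
    (hΛmono : ∀ a b a' b' : ℝ, a ≤ a' → b ≤ b' → Λ a b ≤ Λ a' b')
    (hΛstrict : ∀ a b : ℝ, a ≠ b → Λ a b < max a b)
    (hsqc : ∀ (ω : Ω) (p q y : Ed d), H ((1/2 : ℝ) • (p + q)) y ω ≤ Λ (H p y ω) (H q y ω))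
    (HbarP : Ed d → ℝ) (hHbarP : ∀ p : Ed d, ∀ᵐ ω ∂P, HbarPlusOm d H p ω = HbarP p)
    (Hs : ℝ) (hHs : ∀ᵐ ω ∂P, HstarOm d H ω = Hs)
    (mbar : ℝ → Ed d → ℝ)
    (hmbar : ∀ μ : ℝ, Hs < μ → ∀ y : Ed d, ∀ᵐ ω ∂P,
      Tendsto (fun t : ℝ => t⁻¹ * mMuOm d H μ (t • y) 0 ω) atTop (𝓝 (mbar μ y))) :
    ∀ μ : ℝ, Hs < μ →
      (∀ y : Ed d, IsGreatest {v : ℝ | ∃ p : Ed d, HbarP p ≤ μ ∧ v = ⟪p, y⟫} (mbar μ y)) ∧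
      ({p : Ed d | HbarP p ≤ μ}.Nonempty ∧ IsCompact {p : Ed d | HbarP p ≤ μ} ∧
        Convex ℝ {p : Ed d | HbarP p ≤ μ}) := by
  -- basic facts on the Hamiltonian
  have hbω : ∀ ω : Ω, ∀ R : ℝ, 0 < R → ∃ M : ℝ, ∀ p y : Ed d, ‖p‖ ≤ R → |H p y ω| ≤ M := by
    intro ω R hR
    obtain ⟨M, hM⟩ := hreg_bdd R hR
    exact ⟨M, hM ω⟩
  obtain ⟨c₀, hc₀⟩ : ∃ c₀ : ℝ, ∀ ω p y, c₀ ≤ H p y ω := by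
    obtain ⟨R, hR⟩ := hcoer 0
    obtain ⟨M, hM⟩ := hreg_bdd (max R 1) (by positivity)
    refine ⟨min 0 (-M), fun ω p y => ?_⟩
    rcases le_total R ‖p‖ with h | h
    · exact (min_le_left _ _).trans (hR ω p y h)
    · exact (min_le_right _ _).trans (abs_le.1 (hM ω p y (h.trans (le_max_left _ _)))).1
  have hHm : ∀ p z, Measurable (H p z) := fun p z =>
    hHmeas.comp (measurable_const.prodMk (measurable_const.prodMk measurable_id))
  have hgood : ∀ μ, Hs < μ → ∃ R : ℝ, 0 ≤ R ∧ ∀ᵐ ω ∂P, GoodHam (fun p z => H p z ω) μ R := by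
    intro μ hμ
    obtain ⟨R, hR⟩ := hcoer (μ + 1)
    refine ⟨max R 0, le_max_right _ _, ?_⟩
    filter_upwards [hHs] with ω hω
    refine goodHam_of (ν := (Hs + μ) / 2) (by linarith) (le_max_right _ _) (hHcont ω) (hqc ω) ?_ ?_
      Λ hΛmono hΛstrict (hsqc ω) ?_
    · intro p z hp
      by_contra hcon
      push Not at hcon
      have := hR ω p z ((le_max_left _ _).trans hcon.le)
      have hp : H p z ω ≤ μ := hp
      linarith
    · intro R hR ε hε
      obtain ⟨δ, hδ, h⟩ := hreg_uc R hR ε hε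
      exact ⟨δ, hδ, h ω⟩
    · refine exists_of_Hstar_lt (hbω ω) ?_
      change HstarOm d H ω < _
      rw [hω]; linarith
  -- properties of mbar
  have hhom : ∀ μ, Hs < μ → ∀ c : ℝ, 0 < c → ∀ x, mbar μ (c • x) = c * mbar μ x := by
    intro μ hμ c hc x
    obtain ⟨ω, h1, h2⟩ := ((hmbar μ hμ (c • x)).and (hmbar μ hμ x)).exists
    have h3 : Tendsto (fun t : ℝ => t * c) atTop atTop := tendsto_id.atTop_mul_const hc
    have h4 := (h2.comp h3).const_mul c
    refine tendsto_nhds_unique h1 (h4.congr fun t => ?_)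
    simp only [Function.comp, mul_smul, mul_inv]
    field_simp
  have hzero : ∀ μ, Hs < μ → mbar μ 0 = 0 := by
    intro μ hμ
    have := hhom μ hμ 2 (by norm_num) 0
    rw [smul_zero] at this
    linarith
  have hlip : ∀ μ, ∀ hμ : Hs < μ, ∀ R : ℝ, (∀ᵐ ω ∂P, GoodHam (fun p z => H p z ω) μ R) →
      ∀ x y, |mbar μ x - mbar μ y| ≤ R * dist x y := by
    intro μ hμ R hR x y
    obtain ⟨ω, h1, h2, h3⟩ := ((hmbar μ hμ x).and ((hmbar μ hμ y).and hR)).exists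
    refine le_of_tendsto (h1.sub h2).abs ?_
    filter_upwards [eventually_gt_atTop 0] with t ht
    have h4 : |mMuOm d H μ (t • x) 0 ω - mMuOm d H μ (t • y) 0 ω| ≤ R * dist (t • x) (t • y) :=
      h3.m_lip 0 (t • x) (t • y)
    rw [dist_smul₀, Real.norm_of_nonneg ht.le] at h4
    rw [← mul_sub, abs_mul, abs_of_pos (inv_pos.2 ht), inv_mul_le_iff₀ ht]
    linarith
  have hadd : ∀ μ, Hs < μ → ∀ x y, mbar μ (x + y) ≤ mbar μ x + mbar μ y := by
    intro μ hμ x y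
    obtain ⟨R, hR0, hR⟩ := hgood μ hμ
    have hN : Tendsto (fun n : ℕ => (n : ℝ)) atTop atTop := tendsto_natCast_atTop_atTop
    let g : ℕ → Ω → ℝ := fun n ω => (n : ℝ)⁻¹ * mMuOm d H μ ((n : ℝ) • y) 0 ω
    have hgm : ∀ n, AEStronglyMeasurable (g n) P := fun n =>
      ((aemeasurable_m hHm hR ((n : ℝ) • y)).const_mul _).aestronglyMeasurable
    have hglim : ∀ᵐ ω ∂P, Tendsto (fun n => g n ω) atTop (𝓝 ((fun _ => mbar μ y) ω)) := by
      filter_upwards [hmbar μ hμ y] with ω hω using hω.comp hN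
    have hgP := tendstoInMeasure_of_tendsto_ae hgm hglim
    let g' : ℕ → Ω → ℝ := fun n ω => g n (τ ((n : ℝ) • x) ω)
    have hgP' : TendstoInMeasure P g' atTop (fun _ => mbar μ y) := by
      intro ε hε
      refine (hgP ε hε).congr fun n => ?_
      have hns : NullMeasurableSet {ω | ε ≤ edist (g n ω) (mbar μ y)} P := by
        have : AEMeasurable (fun ω => edist (g n ω) (mbar μ y)) P :=
          (hgm n).aemeasurable.edist aemeasurable_const
        exact this.nullMeasurable measurableSet_Ici
      exact ((hτmp ((n : ℝ) • x)).measure_preimage hns).symm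
    obtain ⟨ns, hns, hnslim⟩ := hgP'.exists_seq_tendsto_ae
    have hRτ : ∀ᵐ ω ∂P, ∀ n : ℕ, GoodHam (fun p z => H p z (τ ((n : ℝ) • x) ω)) μ R := by
      rw [ae_all_iff]
      intro n
      exact (hτmp ((n : ℝ) • x)).quasiMeasurePreserving.ae hR
    obtain ⟨ω, h1, h2, h3, h4, h5⟩ := (hnslim.and ((hmbar μ hμ x).and
      ((hmbar μ hμ (x + y)).and (hR.and hRτ)))).exists
    have hns' : Tendsto (fun k => (ns k : ℝ)) atTop atTop := hN.comp hns.tendsto_atTop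
    refine le_of_tendsto_of_tendsto (h3.comp hns') ((h2.comp hns').add h1) ?_
    refine Eventually.of_forall fun k => ?_
    simp only [Function.comp, g', g]
    rw [← mul_add]
    refine mul_le_mul_of_nonneg_left ?_ (by positivity)
    have h6 := m_shift_le hHstat ((ns k : ℝ) • x) h4 (h5 (ns k)) ((ns k : ℝ) • y)
    have h7 : mMuOm d H μ ((ns k : ℝ) • x + (ns k : ℝ) • y) 0 ω ≤
        mMuOm d H μ ((ns k : ℝ) • x + (ns k : ℝ) • y) ((ns k : ℝ) • x) ω +
        mMuOm d H μ ((ns k : ℝ) • x) 0 ω := h4.m_triangle _ _ _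
    rw [smul_add]
    linarith
  -- dominated slopes are in the sublevel set
  have hup : ∀ μ, Hs < μ → ∀ p, (∀ x, ⟪p, x⟫ ≤ mbar μ x) → HbarP p ≤ μ := by
    intro μ hμ p hp
    obtain ⟨R, hR0, hR⟩ := hgood μ hμ
    let e := TopologicalSpace.denseSeq (Ed d)
    have hlim : ∀ᵐ ω ∂P, ∀ n, Tendsto (fun t : ℝ => t⁻¹ * mMuOm d H μ (t • e n) 0 ω) atTop
        (𝓝 (mbar μ (e n))) := ae_all_iff.2 fun n => hmbar μ hμ (e n)
    obtain ⟨ω, h1, h2, h3⟩ := (hlim.and (hR.and (hHbarP p))).exists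
    rw [← h3]
    let m : Ed d → ℝ := fun x => mMuOm d H μ x 0 ω
    have hmsub : SubSol (fun p z => H p z ω) μ m := h2.m_sub 0
    obtain ⟨hmL, hmae⟩ := (h2.iff_sub m).2 hmsub
    let w : Ed d → ℝ := fun x => ⟪-p, x⟫ + m x
    have hwSL : w ∈ SLplus d := by
      refine ⟨inner_add_mem_Lip (-p) hmL, fun ε hε => ?_⟩
      obtain ⟨r, hr, h⟩ := uniform_lower hR0 (m := m) (N := mbar μ) (fun x y => h2.m_lip 0 x y)
        (hlip μ hμ R hR) (hhom μ hμ) (TopologicalSpace.denseRange_denseSeq (Ed d)) h1 ε hε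
      refine ⟨r, fun y hy => ?_⟩
      have hy0 : 0 < ‖y‖ := lt_of_lt_of_le hr hy
      rw [le_div_iff₀ hy0]
      have h4 := h y hy
      have h5 := hp y
      simp only [w, inner_neg_left]
      linarith
    refine HbarPlus_le (hbω ω) (hc₀ ω) hwSL ?_
    obtain ⟨C, hC⟩ := hmL
    filter_upwards [hmae, hC.ae_differentiableAt] with z hz hzd
    rw [gradient_add_inner (-p) hzd, add_neg_cancel_left]
    exact hz
  -- strict sublevel slopes are dominated
  have hlow : ∀ μ, Hs < μ → ∀ p, HbarP p < μ → ∀ x, ⟪p, x⟫ ≤ mbar μ x := by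
    intro μ hμ p hp x
    by_cases hx : x = 0
    · rw [hx, inner_zero_right, hzero μ hμ]
    obtain ⟨R, hR0, hR⟩ := hgood μ hμ
    obtain ⟨ω, h1, h2, h3⟩ := ((hmbar μ hμ x).and (hR.and (hHbarP p))).exists
    obtain ⟨w, hw, hwae⟩ := exists_of_HbarPlus_lt (hbω ω)
      (show HbarPlus d (fun p z => H p z ω) p < μ by
        change HbarPlusOm d H p ω < μ
        rw [h3]; exact hp)
    have hsub : SubSol (fun p z => H p z ω) μ (fun x => ⟪p, x⟫ + w x) := by
      refine subSol_of_ae (inner_add_mem_Lip p hw.1) ?_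
      obtain ⟨C, hC⟩ := hw.1
      filter_upwards [hwae, hC.ae_differentiableAt] with z hz hzd
      rw [gradient_add_inner p hzd]
      exact hz
    refine le_of_forall_pos_le_add fun ε hε => ?_
    have hx0 : 0 < ‖x‖ := norm_pos_iff.2 hx
    obtain ⟨r, hr⟩ := hw.2 (ε / ‖x‖) (by positivity)
    have hlim2 : Tendsto (fun t : ℝ => t⁻¹ * mMuOm d H μ (t • x) 0 ω + ε + t⁻¹ * w 0) atTop
        (𝓝 (mbar μ x + ε + 0 * w 0)) := (h1.add_const ε).add (tendsto_inv_atTop_zero.mul_const _)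
    rw [zero_mul, add_zero] at hlim2
    refine ge_of_tendsto hlim2 ?_
    filter_upwards [eventually_gt_atTop 0, eventually_ge_atTop (r / ‖x‖)] with t ht htr
    have hnorm : ‖t • x‖ = t * ‖x‖ := by rw [norm_smul, Real.norm_of_nonneg ht.le]
    have h4 := hr (t • x) (by rw [hnorm]; exact (div_le_iff₀ hx0).1 htr)
    rw [hnorm, le_div_iff₀ (by positivity)] at h4
    have h5 : ⟪p, t • x⟫ + w (t • x) - (⟪p, (0 : Ed d)⟫ + w 0) ≤ mMuOm d H μ (t • x) 0 ω :=
      h2.le_m hsub (t • x) 0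
    rw [inner_zero_right, inner_smul_right] at h5
    have h6 : -(ε / ‖x‖) * (t * ‖x‖) = -(ε * t) := by field_simp
    rw [h6] at h4
    have h7 : t⁻¹ * mMuOm d H μ (t • x) 0 ω + ε + t⁻¹ * w 0
        = t⁻¹ * (mMuOm d H μ (t • x) 0 ω + ε * t + w 0) := by field_simp
    rw [h7, le_inv_mul_iff₀ ht]
    linarith
  -- strict midpoint property
  have hmid : ∀ μ p q, HbarP p ≤ μ → HbarP q < μ → HbarP ((1/2 : ℝ) • (p + q)) < μ := by
    intro μ p q hp hq
    have hΛ : Λ μ (HbarP q) < μ := by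
      have := hΛstrict μ (HbarP q) (ne_of_gt hq)
      rwa [max_eq_left hq.le] at this
    obtain ⟨ε, hε, hΛε⟩ : ∃ ε : ℝ, 0 < ε ∧ Λ (μ + ε) (HbarP q + ε) < μ := by
      have hc : Continuous fun ε : ℝ => Λ (μ + ε) (HbarP q + ε) :=
        hΛcont.comp (by fun_prop : Continuous fun ε : ℝ => (μ + ε, HbarP q + ε))
      have ht : Tendsto (fun ε : ℝ => Λ (μ + ε) (HbarP q + ε)) (𝓝[>] 0) (𝓝 (Λ μ (HbarP q))) := by
        have := (hc.tendsto 0).mono_left (nhdsWithin_le_nhds (s := Set.Ioi 0))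
        simpa using this
      obtain ⟨ε, h1, h2⟩ := ((ht.eventually (gt_mem_nhds hΛ)).and self_mem_nhdsWithin).exists
      exact ⟨ε, h2, h1⟩
    obtain ⟨ω, h1, h2, h3⟩ := ((hHbarP p).and ((hHbarP q).and
      (hHbarP ((1/2 : ℝ) • (p + q))))).exists
    rw [← h3]
    obtain ⟨w, hw, hwae⟩ := exists_of_HbarPlus_lt (hbω ω) (p := p) (t := μ + ε)
      (show HbarPlusOm d H p ω < μ + ε by rw [h1]; linarith)
    obtain ⟨w', hw', hwae'⟩ := exists_of_HbarPlus_lt (hbω ω) (p := q) (t := HbarP q + ε)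
      (show HbarPlusOm d H q ω < HbarP q + ε by rw [h2]; linarith)
    refine lt_of_le_of_lt ?_ hΛε
    refine HbarPlus_le (hbω ω) (hc₀ ω) (mid_mem_SLplus hw hw') ?_
    obtain ⟨C, hC⟩ := hw.1
    obtain ⟨C', hC'⟩ := hw'.1
    filter_upwards [hwae, hwae', hC.ae_differentiableAt, hC'.ae_differentiableAt] with z a1 a2 a3 a4
    rw [gradient_mid a3 a4]
    have : (1/2 : ℝ) • (p + q) + (1/2 : ℝ) • (gradient w z + gradient w' z)
        = (1/2 : ℝ) • ((p + gradient w z) + (q + gradient w' z)) := by module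
    rw [this]
    exact (hsqc ω _ _ _).trans (hΛmono _ _ _ _ a1 a2)
  -- conclusion
  intro μ hμ
  obtain ⟨R, hR0, hR⟩ := hgood μ hμ
  have hiff : ∀ p, HbarP p ≤ μ ↔ ∀ x, ⟪p, x⟫ ≤ mbar μ x := by
    intro p
    refine ⟨fun hp x => ?_, hup μ hμ p⟩
    have hν : Hs < (Hs + μ) / 2 := by linarith
    obtain ⟨q, hq, -⟩ := exists_dominated hd (hhom _ hν) (hadd _ hν) (hzero _ hν) 0
    have hq' : HbarP q < μ := (hup _ hν q hq).trans_lt (by linarith)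
    obtain ⟨s, hs, hst⟩ := approx_of_strict (F := HbarP) (p := p) (fun q' => hmid μ p q' hp) hq'
    have ht : Tendsto (fun n => ⟪s n, x⟫) atTop (𝓝 ⟪p, x⟫) := hst.inner tendsto_const_nhds
    exact le_of_tendsto' ht fun n => hlow μ hμ (s n) (hs n) x
  have hex := exists_dominated hd (hhom μ hμ) (hadd μ hμ) (hzero μ hμ)
  refine ⟨fun y => ⟨?_, ?_⟩, ?_, ?_, ?_⟩
  · obtain ⟨p, hp, hpy⟩ := hex y
    exact ⟨p, (hiff p).2 hp, hpy.symm⟩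
  · rintro v ⟨p, hp, rfl⟩
    exact (hiff p).1 hp y
  · obtain ⟨p, hp, -⟩ := hex 0
    exact ⟨p, (hiff p).2 hp⟩
  · refine Metric.isCompact_of_isClosed_isBounded ?_ ?_
    · have : {p : Ed d | HbarP p ≤ μ} = ⋂ x : Ed d, {p | ⟪p, x⟫ ≤ mbar μ x} := by
        ext p
        rw [Set.mem_iInter]
        exact hiff p
      rw [this]
      exact isClosed_iInter fun x => isClosed_le (f := fun p : Ed d => ⟪p, x⟫)
        (by fun_prop) continuous_const
    · refine (Metric.isBounded_closedBall (x := (0 : Ed d)) (r := R)).subset fun p hp => ?_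
      rw [mem_closedBall_zero_iff]
      have h1 := (hiff p).1 hp p
      have h2 := (abs_le.1 (hlip μ hμ R hR p 0)).2
      rw [hzero μ hμ, dist_zero_right, sub_zero] at h2
      rw [real_inner_self_eq_norm_mul_norm] at h1
      by_contra hcon
      push Not at hcon
      nlinarith [norm_nonneg p]
  · intro p hp q hq a b ha hb hab
    refine (hiff _).2 fun x => ?_
    have h1 := (hiff p).1 hp x
    have h2 := (hiff q).1 hq x
    rw [inner_add_left, inner_smul_left, inner_smul_left]
    simp only [conj_trivial]
    calc a * ⟪p, x⟫ + b * ⟪q, x⟫ ≤ a * mbar μ x + b * mbar μ x := by gcongr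
      _ = mbar μ x := by rw [← add_mul, hab, one_mul]
end
end

section
/- The deterministic constant H̄* satisfies H̄* = min_{p ∈ ℝ^d} H̄₊(p); in particular the minimum of H̄₊ over ℝ^d is attained and equals H̄*. -/
open MeasureTheory Filter Topology Bornology
open scoped RealInnerProductSpace NNReal

noncomputable section

/-! ### Chains and the associated intrinsic distance -/

/-- Chains of small steps from a point to another, with their cost. -/
inductive Ch {d : ℕ} (c : Ed d → Ed d → ℝ) (δ : ℝ) (x : Ed d) : Ed d → ℝ → Prop
  | refl : Ch c δ x x 0
  | step {y : Ed d} {t : ℝ} (v : Ed d) (h : Ch c δ x y t) (hv : ‖v‖ < δ) :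
      Ch c δ x (y + v) (t + c y v)

theorem Ch.trans {d : ℕ} {c : Ed d → Ed d → ℝ} {δ : ℝ} {x y z : Ed d} {s t : ℝ}
    (h₁ : Ch c δ x y s) (h₂ : Ch c δ y z t) : Ch c δ x z (s + t) := by
  induction h₂ with
  | refl => simpa using h₁
  | step v h hv ih => rw [← add_assoc]; exact ih.step v hv

theorem Ch.one {d : ℕ} {c : Ed d → Ed d → ℝ} {δ : ℝ} (x v : Ed d) (hv : ‖v‖ < δ) :
    Ch c δ x (x + v) (c x v) := by
  simpa using (Ch.refl (c := c) (δ := δ) (x := x)).step v hv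

theorem Ch.shift {d : ℕ} {c : Ed d → Ed d → ℝ} {δ : ℝ} {x y z : Ed d} {t : ℝ}
    (h : Ch (fun a v => c (a + z) v) δ x y t) : Ch c δ (x + z) (y + z) t := by
  induction h with
  | refl => exact Ch.refl
  | @step y t v h hv ih =>
    have := ih.step v hv
    rwa [add_right_comm] at this

theorem Ch.unshift {d : ℕ} {c : Ed d → Ed d → ℝ} {δ : ℝ} {x y z : Ed d} {t : ℝ}
    (h : Ch c δ (x + z) (y + z) t) : Ch (fun a v => c (a + z) v) δ x y t := by
  have := Ch.shift (c := fun a v => c (a + z) v) (z := -z) (x := x + z) (y := y + z) (δ := δ)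
    (t := t) (by simpa using h)
  simpa using this

theorem Ch.lower {d : ℕ} {c : Ed d → Ed d → ℝ} {δ : ℝ} {x y : Ed d} {t : ℝ} {φ : Ed d → ℝ}
    (hφ : ∀ x v, ‖v‖ < δ → φ (x + v) - φ x ≤ c x v) (h : Ch c δ x y t) : φ y - φ x ≤ t := by
  induction h with
  | refl => simp
  | @step y t v h hv ih => linarith [hφ y v hv]

theorem Ch.line {d : ℕ} {c : Ed d → Ed d → ℝ} {δ L : ℝ} (hδ : 0 < δ)
    (hc : ∀ x v, c x v ≤ L * ‖v‖) (x y : Ed d) : ∃ t ≤ L * ‖y - x‖, Ch c δ x y t := by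
  obtain ⟨n, hn⟩ := exists_nat_gt (‖y - x‖ / δ)
  have hn0 : (0 : ℝ) < n := lt_of_le_of_lt (by positivity) hn
  set v : Ed d := (n : ℝ)⁻¹ • (y - x) with hv
  have hvn : ‖v‖ = ‖y - x‖ / n := by
    rw [hv, norm_smul, norm_inv, Real.norm_natCast]; field_simp
  have hvδ : ‖v‖ < δ := by
    rw [hvn, div_lt_iff₀ hn0]; rw [div_lt_iff₀ hδ] at hn; linarith
  have key : ∀ k : ℕ, ∃ t ≤ L * (k * ‖v‖), Ch c δ x (x + (k : ℝ) • v) t := by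
    intro k
    induction k with
    | zero => exact ⟨0, by simp, by simpa using Ch.refl⟩
    | succ k ih =>
      obtain ⟨t, ht, hch⟩ := ih
      refine ⟨t + c (x + (k : ℝ) • v) v, ?_, ?_⟩
      · have := hc (x + (k : ℝ) • v) v
        push_cast
        linarith
      · have := hch.step v hvδ
        convert this using 1
        push_cast
        rw [add_smul, one_smul, add_assoc]
  obtain ⟨t, ht, hch⟩ := key n
  refine ⟨t, ?_, ?_⟩
  · rw [hvn] at ht
    rwa [mul_div_cancel₀ _ hn0.ne'] at ht
  · rw [hv, smul_smul, mul_inv_cancel₀ hn0.ne', one_smul] at hch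
    simpa using hch

theorem Ch.exists_path {d : ℕ} {c : Ed d → Ed d → ℝ} {δ : ℝ} {x y : Ed d} {t : ℝ}
    (h : Ch c δ x y t) : ∃ (n : ℕ) (Q : ℕ → Ed d), Q 0 = x ∧ Q n = y ∧
      (∀ i < n, ‖Q (i + 1) - Q i‖ < δ) ∧ ∑ i ∈ Finset.range n, c (Q i) (Q (i + 1) - Q i) = t := by
  induction h with
  | refl => exact ⟨0, fun _ => x, by simp⟩
  | @step y t v h hv ih =>
    obtain ⟨n, Q, h0, hn, hs, hsum⟩ := ih
    refine ⟨n + 1, fun i => if i ≤ n then Q i else y + v, by simp [h0], by simp, ?_, ?_⟩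
    · intro i hi
      rcases Nat.lt_succ_iff_lt_or_eq.1 hi with h' | rfl
      · have := hs i h'
        simpa [h'.le, Nat.succ_le_of_lt h'] using this
      · simpa [hn] using hv
    · rw [Finset.sum_range_succ]
      congr 1
      · rw [← hsum]
        refine Finset.sum_congr rfl fun i hi => ?_
        have hi := Finset.mem_range.1 hi
        simp [hi.le, Nat.succ_le_of_lt hi]
      · simp [hn]

theorem Ch.of_path {d : ℕ} {c : Ed d → Ed d → ℝ} {δ : ℝ} (n : ℕ) (Q : ℕ → Ed d)
    (hs : ∀ i < n, ‖Q (i + 1) - Q i‖ < δ) :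
    Ch c δ (Q 0) (Q n) (∑ i ∈ Finset.range n, c (Q i) (Q (i + 1) - Q i)) := by
  induction n with
  | zero => simpa using Ch.refl
  | succ n ih =>
    have := (ih fun i hi => hs i (by omega)).step _ (hs n (by omega))
    rw [Finset.sum_range_succ]
    simpa using this

theorem Ch.measurable {d : ℕ} {Ω : Type*} [MeasurableSpace Ω] {c : Ω → Ed d → Ed d → ℝ} (δ : ℝ)
    (hcc : ∀ ω, Continuous fun q : Ed d × Ed d => c ω q.1 q.2)
    (hcm : ∀ x v, Measurable fun ω => c ω x v) (x y : Ed d) (t : ℝ) :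
    MeasurableSet {ω | ∃ s < t, Ch (c ω) δ x y s} := by
  let Pt : ℕ → (ℕ → Ed d) → ℕ → Ed d := fun n u i => if i = 0 then x else if n ≤ i then y else u i
  have hPc : ∀ n i, Continuous fun u => Pt n u i := by
    intro n i
    simp only [Pt]
    split_ifs
    · exact continuous_const
    · exact continuous_const
    · exact continuous_apply i
  let D : ℕ → ℕ → Ed d := TopologicalSpace.denseSeq (ℕ → Ed d)
  have hset : {ω | ∃ s < t, Ch (c ω) δ x y s} = ⋃ n : ℕ, ⋃ k : ℕ,
      {ω | Pt n (D k) n = y ∧ (∀ i < n, ‖Pt n (D k) (i + 1) - Pt n (D k) i‖ < δ) ∧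
        ∑ i ∈ Finset.range n, c ω (Pt n (D k) i) (Pt n (D k) (i + 1) - Pt n (D k) i) < t} := by
    ext ω
    simp only [Set.mem_ofPred_eq, Set.mem_iUnion]
    constructor
    · rintro ⟨s, hst, hs⟩
      obtain ⟨n, Q, h0, hn, hs, hsum⟩ := hs.exists_path
      refine ⟨n, ?_⟩
      have hPQ : ∀ i ≤ n, Pt n Q i = Q i := by
        intro i hi
        simp only [Pt]
        split_ifs with h1 h2
        · rw [h1, h0]
        · rw [← hn, le_antisymm hi h2]
        · rfl
      have hend : ∀ u, Pt n u n = y := by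
        intro u
        rcases Nat.eq_zero_or_pos n with h | h
        · subst h; simp [Pt, ← h0, hn]
        · simp [Pt, h.ne']
      let U : Set (ℕ → Ed d) := {u | (∀ i < n, ‖Pt n u (i + 1) - Pt n u i‖ < δ) ∧
        ∑ i ∈ Finset.range n, c ω (Pt n u i) (Pt n u (i + 1) - Pt n u i) < t}
      have hU : IsOpen U := by
        have h1 : U = (⋂ i ∈ Finset.range n, {u | ‖Pt n u (i + 1) - Pt n u i‖ < δ}) ∩
          {u | ∑ i ∈ Finset.range n, c ω (Pt n u i) (Pt n u (i + 1) - Pt n u i) < t} := by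
          ext u; simp [U]
        rw [h1]
        refine IsOpen.inter (isOpen_biInter_finset fun i _ => ?_) ?_
        · exact isOpen_lt (((hPc n (i+1)).sub (hPc n i)).norm) continuous_const
        · refine isOpen_lt (continuous_finsetSum _ fun i _ => ?_) continuous_const
          exact (hcc ω).comp ((hPc n i).prodMk ((hPc n (i+1)).sub (hPc n i)))
      have hQ : Q ∈ U := by
        refine ⟨fun i hi => ?_, ?_⟩
        · rw [hPQ _ hi, hPQ _ hi.le]; exact hs i hi
        · refine lt_of_eq_of_lt ?_ hst
          rw [← hsum]
          refine Finset.sum_congr rfl fun i hi => ?_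
          have hi := Finset.mem_range.1 hi
          rw [hPQ _ (Nat.succ_le_of_lt hi), hPQ _ hi.le]
      obtain ⟨k, hu⟩ :=
        (TopologicalSpace.denseRange_denseSeq (ℕ → Ed d)).exists_mem_open hU ⟨Q, hQ⟩
      exact ⟨k, hend _, hu⟩
    · rintro ⟨n, k, h1, h2, h3⟩
      have := Ch.of_path (c := c ω) n (Pt n (D k)) h2
      rw [h1] at this
      exact ⟨_, h3, by simpa [Pt] using this⟩
  rw [hset]
  refine MeasurableSet.iUnion fun n => MeasurableSet.iUnion fun k => ?_
  by_cases h : Pt n (D k) n = y ∧ (∀ i < n, ‖Pt n (D k) (i + 1) - Pt n (D k) i‖ < δ)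
  · have : {ω | Pt n (D k) n = y ∧ (∀ i < n, ‖Pt n (D k) (i + 1) - Pt n (D k) i‖ < δ) ∧
        ∑ i ∈ Finset.range n, c ω (Pt n (D k) i) (Pt n (D k) (i + 1) - Pt n (D k) i) < t} =
        {ω | ∑ i ∈ Finset.range n, c ω (Pt n (D k) i) (Pt n (D k) (i + 1) - Pt n (D k) i) < t} := by
      ext ω
      exact ⟨fun h' => h'.2.2, fun h' => ⟨h.1, h.2, h'⟩⟩
    rw [this]
    exact measurableSet_lt (Finset.measurable_sum _ fun i _ => hcm _ _) measurable_const
  · convert MeasurableSet.empty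
    ext ω
    simp only [Set.mem_ofPred_eq, Set.mem_empty_iff_false, iff_false]
    exact fun h' => h ⟨h'.1, h'.2.1⟩

/-- The truncated intrinsic distance from the origin. -/
def Mm {d : ℕ} (c : Ed d → Ed d → ℝ) (δ L : ℝ) (y : Ed d) : ℝ :=
  sInf {s | ∃ t, Ch c δ 0 y t ∧ s = max t (-(L * ‖y‖))}

/-- A cost admitting a potential. -/
def GoodC {d : ℕ} (c : Ed d → Ed d → ℝ) (δ : ℝ) : Prop :=
  ∃ φ : Ed d → ℝ, ∀ x v, ‖v‖ < δ → φ (x + v) - φ x ≤ c x v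

theorem GoodC.shift {d : ℕ} {c : Ed d → Ed d → ℝ} {δ : ℝ} (h : GoodC c δ) (z : Ed d) :
    GoodC (fun a v => c (a + z) v) δ := by
  obtain ⟨φ, hφ⟩ := h
  refine ⟨fun x => φ (x + z), fun x v hv => ?_⟩
  have := hφ (x + z) v hv
  rwa [add_right_comm] at this

theorem GoodC.lower {d : ℕ} {c : Ed d → Ed d → ℝ} {δ L : ℝ} (hδ : 0 < δ)
    (hc : ∀ x v, c x v ≤ L * ‖v‖) (h : GoodC c δ) {x y : Ed d} {t : ℝ} (hch : Ch c δ x y t) :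
    -(L * ‖y - x‖) ≤ t := by
  obtain ⟨φ, hφ⟩ := h
  obtain ⟨s, hs, hcs⟩ := Ch.line hδ hc y x
  have h1 := hch.lower hφ
  have h2 := hcs.lower hφ
  rw [norm_sub_rev] at hs
  linarith

theorem Mm_bdd {d : ℕ} (c : Ed d → Ed d → ℝ) (δ L : ℝ) (y : Ed d) :
    BddBelow {s | ∃ t, Ch c δ 0 y t ∧ s = max t (-(L * ‖y‖))} :=
  ⟨-(L * ‖y‖), by rintro s ⟨t, _, rfl⟩; exact le_max_right _ _⟩

theorem Mm_nonempty {d : ℕ} {c : Ed d → Ed d → ℝ} {δ L : ℝ} (hδ : 0 < δ)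
    (hc : ∀ x v, c x v ≤ L * ‖v‖) (y : Ed d) :
    {s | ∃ t, Ch c δ 0 y t ∧ s = max t (-(L * ‖y‖))}.Nonempty := by
  obtain ⟨t, _, h⟩ := Ch.line hδ hc 0 y
  exact ⟨_, t, h, rfl⟩

theorem Mm_lt_iff {d : ℕ} {c : Ed d → Ed d → ℝ} {δ L : ℝ} (hδ : 0 < δ)
    (hc : ∀ x v, c x v ≤ L * ‖v‖) (y : Ed d) (t : ℝ) :
    Mm c δ L y < t ↔ -(L * ‖y‖) < t ∧ ∃ s < t, Ch c δ 0 y s := by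
  rw [Mm, csInf_lt_iff (Mm_bdd c δ L y) (Mm_nonempty hδ hc y)]
  constructor
  · rintro ⟨_, ⟨s, hs, rfl⟩, h⟩
    rw [max_lt_iff] at h
    exact ⟨h.2, s, h.1, hs⟩
  · rintro ⟨h, s, hst, hs⟩
    exact ⟨_, ⟨s, hs, rfl⟩, max_lt hst h⟩

theorem Mm_le {d : ℕ} {c : Ed d → Ed d → ℝ} {δ L : ℝ} (hδ : 0 < δ)
    (hc : ∀ x v, c x v ≤ L * ‖v‖) (h : GoodC c δ) {y : Ed d} {t : ℝ} (hch : Ch c δ 0 y t) :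
    Mm c δ L y ≤ t := by
  refine (csInf_le (Mm_bdd c δ L y) ⟨t, hch, rfl⟩).trans (max_le le_rfl ?_)
  simpa using h.lower hδ hc hch

theorem Mm_ge {d : ℕ} {c : Ed d → Ed d → ℝ} {δ L : ℝ} (hδ : 0 < δ)
    (hc : ∀ x v, c x v ≤ L * ‖v‖) (y : Ed d) : -(L * ‖y‖) ≤ Mm c δ L y :=
  le_csInf (Mm_nonempty hδ hc y) (by rintro s ⟨t, _, rfl⟩; exact le_max_right _ _)

theorem Mm_le_norm {d : ℕ} {c : Ed d → Ed d → ℝ} {δ L : ℝ} (hδ : 0 < δ) (hL : 0 ≤ L)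
    (hc : ∀ x v, c x v ≤ L * ‖v‖) (y : Ed d) : Mm c δ L y ≤ L * ‖y‖ := by
  obtain ⟨t, ht, h⟩ := Ch.line hδ hc 0 y
  refine (csInf_le (Mm_bdd c δ L y) ⟨t, h, rfl⟩).trans (max_le (by simpa using ht) ?_)
  have : 0 ≤ L * ‖y‖ := by positivity
  linarith

theorem Mm_trans {d : ℕ} {c : Ed d → Ed d → ℝ} {δ L : ℝ} (hδ : 0 < δ)
    (hc : ∀ x v, c x v ≤ L * ‖v‖) (h : GoodC c δ) {x y : Ed d} {t : ℝ} (hch : Ch c δ x y t) :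
    Mm c δ L y ≤ Mm c δ L x + t := by
  refine le_of_forall_pos_lt_add fun ε hε => ?_
  obtain ⟨-, s, hs, hcs⟩ := (Mm_lt_iff hδ hc x (Mm c δ L x + ε)).1 (by linarith)
  have := Mm_le hδ hc h (hcs.trans hch)
  linarith

theorem Mm_add {d : ℕ} {c : Ed d → Ed d → ℝ} {δ L : ℝ} (hδ : 0 < δ)
    (hc : ∀ x v, c x v ≤ L * ‖v‖) (h : GoodC c δ) (x y : Ed d) :
    Mm c δ L (x + y) ≤ Mm c δ L x + Mm (fun a v => c (a + x) v) δ L y := by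
  refine le_of_forall_pos_lt_add fun ε hε => ?_
  obtain ⟨-, s, hs, hcs⟩ := (Mm_lt_iff (c := fun a v => c (a + x) v) hδ (fun a v => hc (a + x) v) y
    (Mm (fun a v => c (a + x) v) δ L y + ε)).1 (by linarith)
  have h1 := hcs.shift
  rw [zero_add, add_comm y x] at h1
  have := Mm_trans hδ hc h h1
  linarith

theorem Mm_lip {d : ℕ} {c : Ed d → Ed d → ℝ} {δ L : ℝ} (hδ : 0 < δ)
    (hc : ∀ x v, c x v ≤ L * ‖v‖) (h : GoodC c δ) (x y : Ed d) :
    Mm c δ L y ≤ Mm c δ L x + L * ‖y - x‖ := by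
  obtain ⟨t, ht, hch⟩ := Ch.line hδ hc x y
  linarith [Mm_trans hδ hc h hch]

/-! ### Abstract ergodic lower bound (Katznelson-Weiss) -/

theorem kw_pointwise {Ω : Type*} {T : Ω → Ω} {𝒢 : Set Ω} (hT : ∀ ω ∈ 𝒢, T ω ∈ 𝒢)
    {g : ℕ → Ω → ℝ} {L a D : ℝ} (hg0 : ∀ ω ∈ 𝒢, g 0 ω ≤ 0)
    (hsub : ∀ ω ∈ 𝒢, ∀ m n, g (m + n) ω ≤ g m ω + g n (T^[m] ω))
    (hup : ∀ ω ∈ 𝒢, ∀ n : ℕ, g n ω ≤ L * n) (N : ℕ) (B : Set Ω)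
    (hB : ∀ ω ∈ B, ∃ n : ℕ, 1 ≤ n ∧ n ≤ N ∧ g n ω ≤ n * a) (hD : 0 ≤ D) (hLD : L ≤ a + D)
    (K : ℕ) : ∀ ω ∈ 𝒢, g K ω ≤ ∑ j ∈ Finset.range K, (a + D * Bᶜ.indicator 1 (T^[j] ω)) + N * D := by
  classical
  have hiter : ∀ n, ∀ ω ∈ 𝒢, T^[n] ω ∈ 𝒢 := by
    intro n
    induction n with
    | zero => exact fun ω h => h
    | succ n ih => intro ω h; rw [Function.iterate_succ_apply]; exact ih _ (hT _ h)
  have hnn : ∀ ω, 0 ≤ D * Bᶜ.indicator (1 : Ω → ℝ) ω := by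
    intro ω
    refine mul_nonneg hD (Set.indicator_nonneg (fun _ _ => ?_) _)
    simp
  have hge : ∀ (n : ℕ) ω, (n : ℝ) * a ≤ ∑ j ∈ Finset.range n, (a + D * Bᶜ.indicator 1 (T^[j] ω)) := by
    intro n ω
    calc (n : ℝ) * a = ∑ j ∈ Finset.range n, a := by simp
      _ ≤ _ := Finset.sum_le_sum fun j _ => by linarith [hnn (T^[j] ω)]
  induction K using Nat.strong_induction_on with
  | _ K ih =>
    intro ω hω
    rcases Nat.eq_zero_or_pos K with rfl | hK
    · have : (0:ℝ) ≤ N * D := by positivity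
      simpa using (hg0 ω hω).trans this
    by_cases hb : ω ∈ B
    · obtain ⟨n, hn1, hnN, hgn⟩ := hB ω hb
      rcases le_or_gt n K with hnK | hnK
      · obtain ⟨r, rfl⟩ := Nat.exists_eq_add_of_le hnK
        have h1 := hsub ω hω n r
        have h2 := ih r (by omega) _ (hiter n ω hω)
        rw [Finset.sum_range_add]
        have h3 := hge n ω
        simp only [← Function.iterate_add_apply] at h2
        simp only [add_comm n] at h1 ⊢
        linarith
      · have h1 := hup ω hω K
        have h3 := hge K ω
        have h4 : (K : ℝ) ≤ N := by exact_mod_cast (hnK.le.trans hnN)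
        have h5 : (K : ℝ) * D ≤ N * D := mul_le_mul_of_nonneg_right h4 hD
        have h6 : L * K ≤ (a + D) * K := mul_le_mul_of_nonneg_right hLD (by positivity)
        linarith
    · obtain ⟨r, rfl⟩ := Nat.exists_eq_add_of_le hK
      have h1 := hsub ω hω 1 r
      have h2 := ih r (by omega) _ (hiter 1 ω hω)
      have h3 := hup ω hω 1
      rw [Finset.sum_range_add]
      simp only [← Function.iterate_add_apply] at h2
      simp only [add_comm 1]
      have h4 : Bᶜ.indicator (1 : Ω → ℝ) ω = 1 := by simp [hb]
      simp only [Finset.sum_range_one, Function.iterate_zero, id_eq, h4]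
      push_cast at h3
      rw [add_comm 1 r] at h1
      linarith

theorem kw_lower {Ω : Type*} [MeasurableSpace Ω] {P : Measure Ω} [IsProbabilityMeasure P]
    {T : Ω → Ω} (hTm : MeasurePreserving T P P) {𝒢 : Set Ω} (hT : ∀ ω ∈ 𝒢, T ω ∈ 𝒢)
    (h𝒢 : ∀ᵐ ω ∂P, ω ∈ 𝒢)
    {g : ℕ → Ω → ℝ} {L a b : ℝ} (hL : 0 ≤ L) (hgm : ∀ n, Measurable (g n))
    (hsub : ∀ ω ∈ 𝒢, ∀ m n, g (m + n) ω ≤ g m ω + g n (T^[m] ω))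
    (hup : ∀ ω ∈ 𝒢, ∀ n : ℕ, |g n ω| ≤ L * n)
    (ha : ∀ᵐ ω ∂P, ∀ ε > 0, ∃ n : ℕ, 1 ≤ n ∧ g n ω ≤ n * (a + ε))
    (hb : ∀ n : ℕ, b * n ≤ ∫ ω, g n ω ∂P) : b ≤ a := by
  set D := L + |a| with hDdef
  have hD : 0 ≤ D := by positivity
  suffices H : ∀ ε > 0, b ≤ a + ε + D * ε by
    by_contra! hcon
    have := H ((b - a) / (2 * (1 + D))) (by apply div_pos <;> linarith)
    have h2 : (b - a) / (2 * (1 + D)) * (1 + D) = (b - a) / 2 := by field_simp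
    nlinarith
  intro ε hε
  let B : ℕ → Set Ω := fun N => ⋃ n ∈ Finset.Icc 1 N, {ω | g n ω ≤ n * (a + ε)}
  have hBm : ∀ N, MeasurableSet (B N) := fun N =>
    Finset.measurableSet_biUnion _ fun n _ => measurableSet_le (hgm n) measurable_const
  have hBmono : Monotone B := by
    intro N N' h ω hω
    simp only [B, Set.mem_iUnion, Finset.mem_Icc] at hω ⊢
    obtain ⟨n, hn, h'⟩ := hω
    exact ⟨n, ⟨hn.1, hn.2.trans h⟩, h'⟩
  have hBU : P (⋃ N, B N) = 1 := by
    rw [prob_compl_eq_zero_iff (MeasurableSet.iUnion hBm) |>.symm]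
    refine measure_mono_null ?_ ha
    intro ω hω h
    obtain ⟨n, hn, h'⟩ := h ε hε
    refine hω (Set.mem_iUnion.2 ⟨n, ?_⟩)
    simp only [B, Set.mem_iUnion, Finset.mem_Icc]
    exact ⟨n, ⟨hn, le_rfl⟩, h'⟩
  have hlim : Tendsto (fun N => P.real (B N)) atTop (𝓝 1) := by
    have := tendsto_measure_iUnion_atTop (μ := P) hBmono
    rw [hBU] at this
    have h2 := (ENNReal.tendsto_toReal (by simp)).comp this
    rw [ENNReal.toReal_one] at h2
    exact h2
  obtain ⟨N, hN⟩ := (hlim.eventually (lt_mem_nhds (show 1 - ε < 1 by linarith))).exists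
  have hBc : P.real (B N)ᶜ ≤ ε := by
    rw [probReal_compl_eq_one_sub (hBm N)]; linarith
  have hgInt : ∀ n, Integrable (g n) P := by
    intro n
    refine Integrable.of_bound (hgm n).aestronglyMeasurable (L * n) ?_
    filter_upwards [h𝒢] with ω hω using hup ω hω n
  have hTn : ∀ j : ℕ, MeasurePreserving (T^[j]) P P := fun j => hTm.iterate j
  have hind : Integrable ((B N)ᶜ.indicator (1 : Ω → ℝ)) P :=
    (integrable_const (1 : ℝ)).indicator (hBm N).compl
  have hindj : ∀ j : ℕ, Integrable (fun ω => (a + ε) + D * (B N)ᶜ.indicator (1 : Ω → ℝ) (T^[j] ω)) P := by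
    intro j
    exact (integrable_const _).add (((hTn j).integrable_comp_of_integrable hind).const_mul D)
  have hintj : ∀ j : ℕ, ∫ ω, ((a + ε) + D * (B N)ᶜ.indicator (1 : Ω → ℝ) (T^[j] ω)) ∂P
      ≤ a + ε + D * ε := by
    intro j
    have e1 : ∫ ω, (B N)ᶜ.indicator (1 : Ω → ℝ) (T^[j] ω) ∂P = P.real (B N)ᶜ := by
      have h1 : (fun ω => (B N)ᶜ.indicator (1 : Ω → ℝ) (T^[j] ω)) =
          ((T^[j]) ⁻¹' (B N)ᶜ).indicator 1 := by
        rfl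
      rw [h1, integral_indicator_one ((hTn j).measurable (hBm N).compl), Measure.real, Measure.real,
        (hTn j).measure_preimage (hBm N).compl.nullMeasurableSet]
    have hi2 : Integrable (fun ω => (B N)ᶜ.indicator (1 : Ω → ℝ) (T^[j] ω)) P :=
      (hTn j).integrable_comp_of_integrable hind
    rw [integral_add (integrable_const _)
      (hi2.const_mul D), integral_const_mul, e1]
    simp only [integral_const, probReal_univ, one_smul]
    gcongr
  have key : ∀ K : ℕ, b * K ≤ K * (a + ε + D * ε) + N * D := by
    intro K
    refine (hb K).trans ?_
    have h1 : ∫ ω, g K ω ∂P ≤ ∫ ω, (∑ j ∈ Finset.range K,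
        ((a + ε) + D * (B N)ᶜ.indicator (1 : Ω → ℝ) (T^[j] ω)) + N * D) ∂P := by
      refine integral_mono_ae (hgInt K)
        ((integrable_finsetSum _ fun j _ => hindj j).add (integrable_const _)) ?_
      filter_upwards [h𝒢] with ω hω
      refine kw_pointwise hT (L := L) (fun ω h => ?_) hsub
        (fun ω h n => (le_abs_self _).trans (hup ω h n)) N (B N) ?_ hD ?_ K ω hω
      · have := (le_abs_self _).trans (hup ω h 0); simpa using this
      · intro ω h
        simp only [B, Set.mem_iUnion, Finset.mem_Icc] at h
        obtain ⟨n, hn, h'⟩ := h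
        exact ⟨n, hn.1, hn.2, h'⟩
      · have := neg_abs_le a; linarith
    refine h1.trans ?_
    rw [integral_add (integrable_finsetSum _ fun j _ => hindj j) (integrable_const _),
      integral_finsetSum _ fun j _ => hindj j]
    simp only [integral_const, probReal_univ, one_smul]
    have := Finset.sum_le_sum fun j (_ : j ∈ Finset.range K) => hintj j
    simp only [Finset.sum_const, Finset.card_range, nsmul_eq_mul] at this
    linarith
  by_contra! hcon
  obtain ⟨K, hK⟩ := exists_nat_gt (N * D / (b - (a + ε + D * ε)))
  rw [div_lt_iff₀ (by linarith)] at hK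
  have := key K
  linarith

/-! ### A Hahn-Banach lemma -/

theorem hb_lemma {d : ℕ} {h : Ed d → ℝ} {L : ℝ} (hL : 0 ≤ L) (hadd : ∀ x y, h (x + y) ≤ h x + h y)
    (hlip : ∀ x y, h y ≤ h x + L * ‖y - x‖) : ∃ p : Ed d, ∀ x, ⟪p, x⟫ ≤ h x := by
  have h0 : 0 ≤ h 0 := by have := hadd 0 0; simp at this; linarith
  have hlow : ∀ x, -(L * ‖x‖) ≤ h x := by
    intro x; have := hlip x 0; simp at this; linarith
  let N : Ed d → ℝ := fun x => sInf {s | ∃ t : ℝ, 0 < t ∧ s = h (t • x) / t}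
  have hbdd : ∀ x, BddBelow {s | ∃ t : ℝ, 0 < t ∧ s = h (t • x) / t} := by
    intro x
    refine ⟨-(L * ‖x‖), ?_⟩
    rintro s ⟨t, ht, rfl⟩
    rw [le_div_iff₀ ht]
    have := hlow (t • x)
    rw [norm_smul, Real.norm_of_nonneg ht.le] at this
    linarith
  have hne : ∀ x, {s | ∃ t : ℝ, 0 < t ∧ s = h (t • x) / t}.Nonempty := fun x => ⟨_, 1, one_pos, rfl⟩
  have hNle : ∀ x t, 0 < t → N x ≤ h (t • x) / t := fun x t ht => csInf_le (hbdd x) ⟨t, ht, rfl⟩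
  have hmul : ∀ x (k : ℕ), h (((k : ℝ) + 1) • x) ≤ (k + 1) * h x := by
    intro x k
    induction k with
    | zero => simp
    | succ k ih =>
      push_cast
      rw [add_smul, one_smul]
      have := hadd (((k : ℝ) + 1) • x) x
      linarith
  have hev : ∀ x (a ε : ℝ), 0 < a → 0 < ε → ∀ᶠ T : ℝ in atTop, h (T • x) ≤ T * (h (a • x) / a + ε) := by
    intro x a ε ha hε
    set C := |h (a • x)| + 2 * (L * (a * ‖x‖)) + 1 with hC
    filter_upwards [eventually_gt_atTop (2 * a), eventually_gt_atTop (C / ε)] with T hT1 hT2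
    rw [div_lt_iff₀ hε] at hT2
    have hTa : 2 < T / a := by rw [lt_div_iff₀ ha]; linarith
    obtain ⟨k, hk⟩ : ∃ k : ℕ, ⌊T / a⌋₊ = k + 1 := by
      refine Nat.exists_eq_succ_of_ne_zero ?_
      have : 2 ≤ ⌊T / a⌋₊ := Nat.le_floor (by push_cast; linarith)
      omega
    have hf1 := Nat.floor_le (show 0 ≤ T / a by linarith)
    have hf2 := Nat.lt_floor_add_one (T / a)
    rw [hk] at hf1 hf2
    push_cast at hf1 hf2
    rw [le_div_iff₀ ha] at hf1
    rw [div_lt_iff₀ ha] at hf2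
    have h1 := hmul (a • x) k
    have h2 := hlip (((k : ℝ) + 1) • a • x) (T • x)
    rw [smul_smul, ← sub_smul, norm_smul, Real.norm_of_nonneg (by linarith)] at h2
    rw [smul_smul] at h1
    have h3 : L * ((T - (k + 1) * a) * ‖x‖) ≤ L * (a * ‖x‖) := by
      gcongr; linarith
    have h4 : T * (h (a • x) / a) - (k + 1) * h (a • x) = (T / a - (k + 1)) * h (a • x) := by
      field_simp
    have h5 : |(T / a - (k + 1)) * h (a • x)| ≤ 1 * |h (a • x)| := by
      rw [abs_mul]
      refine mul_le_mul_of_nonneg_right ?_ (abs_nonneg _)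
      rw [abs_of_nonneg]
      · rw [sub_le_iff_le_add, div_le_iff₀ ha]; linarith
      · rw [sub_nonneg, le_div_iff₀ ha]; linarith
    have h6 := neg_abs_le ((T / a - (k + 1)) * h (a • x))
    have h7 : 0 ≤ L * (a * ‖x‖) := by positivity
    rw [mul_add]
    nlinarith
  have hNhom : ∀ c : ℝ, 0 < c → ∀ x, N (c • x) = c * N x := by
    have hle : ∀ c : ℝ, 0 < c → ∀ x, c * N x ≤ N (c • x) := by
      intro c hc x
      refine le_csInf (hne _) ?_
      rintro s ⟨t, ht, rfl⟩
      have := hNle x (t * c) (by positivity)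
      rw [smul_smul]
      calc c * N x ≤ c * (h ((t * c) • x) / (t * c)) := by gcongr
        _ = _ := by field_simp
    intro c hc x
    refine le_antisymm ?_ (hle c hc x)
    have := hle c⁻¹ (by positivity) (c • x)
    rw [smul_smul, inv_mul_cancel₀ hc.ne', one_smul] at this
    rwa [inv_mul_le_iff₀ hc] at this
  have hNadd : ∀ x y, N (x + y) ≤ N x + N y := by
    intro x y
    refine le_of_forall_pos_lt_add fun ε hε => ?_
    obtain ⟨_, ⟨a, ha, rfl⟩, h1⟩ := exists_lt_of_csInf_lt (hne x) (show N x < N x + ε / 4 by linarith)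
    obtain ⟨_, ⟨b, hb, rfl⟩, h2⟩ := exists_lt_of_csInf_lt (hne y) (show N y < N y + ε / 4 by linarith)
    obtain ⟨T, hT0, hTx, hTy⟩ := ((eventually_gt_atTop (0 : ℝ)).and
      ((hev x a (ε / 8) ha (by positivity)).and (hev y b (ε / 8) hb (by positivity)))).exists
    have h3 := hNle (x + y) T hT0
    have h4 : h (T • (x + y)) / T ≤ (h (a • x) / a + ε / 8) + (h (b • y) / b + ε / 8) := by
      rw [div_le_iff₀ hT0, smul_add]
      have := hadd (T • x) (T • y)
      linarith
    linarith
  obtain ⟨g, -, hg⟩ := exists_extension_of_le_sublinear (⟨⊥, 0⟩ : Ed d →ₗ.[ℝ] ℝ) N hNhom hNadd (by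
    rintro ⟨x, hx⟩
    have hx0 : x = 0 := by simpa using hx
    have hN0 : N 0 = 0 := by
      have := hNhom 2 (by norm_num) 0
      rw [smul_zero] at this; linarith
    subst hx0
    simp [hN0])
  refine ⟨(InnerProductSpace.toDual ℝ (Ed d)).symm (LinearMap.toContinuousLinearMap g), fun x => ?_⟩
  rw [InnerProductSpace.toDual_symm_apply]
  have := (hg x).trans (hNle x 1 one_pos)
  simpa using this

/-! ### Deterministic part: support-type cost -/

theorem line_ineq {d : ℕ} {w : Ed d → ℝ} {C : ℝ≥0} (hw : LipschitzWith C w) {δ : ℝ}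
    (x v : Ed d) (S : ℝ) (hv : ‖v‖ < δ)
    (h : ∀ᵐ z : Ed d, ‖z - x‖ < 2 * δ → ⟪gradient w z, v⟫ ≤ S) : w (x + v) - w x ≤ S := by
  have hδ : 0 < δ := (norm_nonneg v).trans_lt hv
  have h2 : ∀ᵐ z : Ed d, DifferentiableAt ℝ w z ∧ (‖z - x‖ < 2 * δ → ⟪gradient w z, v⟫ ≤ S) :=
    (hw.ae_differentiableAt).and h
  obtain ⟨N, hN, hNm, hN0⟩ := exists_measurable_superset_of_null (mem_ae_iff.1 h2)
  have h3 : ∀ᵐ t : ℝ, ∀ᵐ z : Ed d, z + t • v ∉ N := by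
    refine Eventually.of_forall fun t => ?_
    have := (measurePreserving_add_right (volume : Measure (Ed d)) (t • v)).quasiMeasurePreserving
    exact this.ae (p := fun y => y ∉ N) (by rw [ae_iff]; simpa using hN0)
  have hms : MeasurableSet {q : ℝ × Ed d | q.2 + q.1 • v ∉ N} :=
    (hNm.preimage (by fun_prop : Measurable fun q : ℝ × Ed d => q.2 + q.1 • v)).compl
  have h4 := (Measure.ae_ae_comm (p := fun (t : ℝ) (z : Ed d) => z + t • v ∉ N) hms).1 h3
  have hd := Measure.dense_of_ae h4
  have h5 : ∀ z, ‖z - x‖ < δ → (∀ᵐ t : ℝ, z + t • v ∉ N) → w (z + v) - w z ≤ S := by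
    intro z hz hzN
    set f : ℝ → ℝ := fun t => w (z + t • v) with hf
    have hfl : LipschitzWith (C * ‖v‖₊) f := by
      refine LipschitzWith.of_dist_le_mul fun s t => ?_
      refine (hw.dist_le_mul _ _).trans ?_
      rw [dist_add_left, dist_eq_norm, ← sub_smul, norm_smul, Real.dist_eq, Real.norm_eq_abs]
      simp only [NNReal.coe_mul, coe_nnnorm]
      apply le_of_eq; ring
    have hac : AbsolutelyContinuousOnInterval f 0 1 :=
      (hfl.lipschitzOnWith).absolutelyContinuousOnInterval
    have e := hac.integral_deriv_eq_sub
    have hle : (∫ t in (0:ℝ)..1, deriv f t) ≤ ∫ t in (0:ℝ)..1, S := by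
      refine intervalIntegral.integral_mono_ae_restrict zero_le_one hac.intervalIntegrable_deriv
        (by simp) ?_
      filter_upwards [ae_restrict_of_ae hzN, ae_restrict_mem measurableSet_Icc] with t ht htI
      have hg : DifferentiableAt ℝ w (z + t • v) ∧
          (‖z + t • v - x‖ < 2 * δ → ⟪gradient w (z + t • v), v⟫ ≤ S) := by
        by_contra hcon
        exact ht (hN hcon)
      have hn : ‖z + t • v - x‖ < 2 * δ := by
        have e1 : z + t • v - x = (z - x) + t • v := by abel
        have : ‖t • v‖ ≤ ‖v‖ := by
          rw [norm_smul, Real.norm_eq_abs, abs_of_nonneg htI.1]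
          nlinarith [norm_nonneg v, htI.2]
        rw [e1]
        linarith [norm_add_le (z - x) (t • v)]
      have hder : HasDerivAt f ⟪gradient w (z + t • v), v⟫ t := by
        have h1 := hg.1.hasGradientAt.hasFDerivAt
        have h2 : HasDerivAt (fun t : ℝ => z + t • v) v t := by
          simpa using ((hasDerivAt_id t).smul_const v).const_add z
        have h3 := h1.comp_hasDerivAt t h2
        rw [InnerProductSpace.toDual_apply_apply] at h3
        exact h3
      rw [hder.deriv]
      exact hg.2 hn
    rw [e] at hle
    simpa [hf] using hle
  refine le_of_forall_pos_lt_add fun ε hε => ?_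
  have hopen : IsOpen {z : Ed d | ‖z - x‖ < δ ∧ w (x + v) - w x < w (z + v) - w z + ε} := by
    have := hw.continuous
    have c1 : Continuous fun z : Ed d => ‖z - x‖ := by fun_prop
    have c2 : Continuous fun z : Ed d => w (z + v) - w z + ε := by fun_prop
    exact (isOpen_lt c1 continuous_const).inter (isOpen_lt continuous_const c2)
  obtain ⟨z, hz1, hz2⟩ := hd.inter_open_nonempty _ hopen ⟨x, by simpa using ⟨hδ, hε⟩⟩
  have := h5 z hz1.1 hz2
  linarith [hz1.2]

/-- The relaxed support function. -/
def Sc {d : ℕ} (G : Ed d → Ed d → ℝ) (L K μ : ℝ) (x v : Ed d) : ℝ :=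
  sSup ((fun p => ⟪p, v⟫ - K * ‖v‖ * max (G p x - μ) 0) '' Metric.closedBall (0 : Ed d) L)

theorem Sc_bdd {d : ℕ} {G : Ed d → Ed d → ℝ} (hG : Continuous fun q : Ed d × Ed d => G q.1 q.2)
    (L K μ : ℝ) (x v : Ed d) :
    BddAbove ((fun p => ⟪p, v⟫ - K * ‖v‖ * max (G p x - μ) 0) '' Metric.closedBall (0 : Ed d) L) := by
  refine ((isCompact_closedBall (0 : Ed d) L).image ?_).bddAbove
  have : Continuous fun p => G p x := hG.comp (by fun_prop : Continuous fun p => (p, x))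
  fun_prop

theorem le_Sc {d : ℕ} {G : Ed d → Ed d → ℝ} (hG : Continuous fun q : Ed d × Ed d => G q.1 q.2)
    {L K μ : ℝ} {x v p : Ed d} (hp : ‖p‖ ≤ L) :
    ⟪p, v⟫ - K * ‖v‖ * max (G p x - μ) 0 ≤ Sc G L K μ x v :=
  le_csSup (Sc_bdd hG L K μ x v) ⟨p, by simpa using hp, rfl⟩

theorem Sc_le {d : ℕ} {G : Ed d → Ed d → ℝ} {L K μ : ℝ} (hL : 0 ≤ L) {x v : Ed d} {t : ℝ}
    (h : ∀ p, ‖p‖ ≤ L → ⟪p, v⟫ - K * ‖v‖ * max (G p x - μ) 0 ≤ t) :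
    Sc G L K μ x v ≤ t := by
  refine csSup_le ⟨_, 0, by simpa using hL, rfl⟩ ?_
  rintro _ ⟨p, hp, rfl⟩
  exact h p (by simpa using hp)

theorem Sc_le_norm {d : ℕ} {G : Ed d → Ed d → ℝ} {L K μ : ℝ} (hL : 0 ≤ L) (hK : 0 ≤ K)
    (x v : Ed d) : Sc G L K μ x v ≤ L * ‖v‖ := by
  refine Sc_le hL fun p hp => ?_
  have h1 := real_inner_le_norm p v
  have h2 : 0 ≤ K * ‖v‖ * max (G p x - μ) 0 := by positivity
  have h3 : ‖p‖ * ‖v‖ ≤ L * ‖v‖ := by gcongr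
  linarith

theorem Sc_cont {d : ℕ} {G : Ed d → Ed d → ℝ} (hG : Continuous fun q : Ed d × Ed d => G q.1 q.2)
    (L K μ : ℝ) : Continuous fun q : Ed d × Ed d => Sc G L K μ q.1 q.2 := by
  unfold Sc
  refine IsCompact.continuous_sSup (f := fun (q : Ed d × Ed d) (p : Ed d) =>
    ⟪p, q.2⟫ - K * ‖q.2‖ * max (G p q.1 - μ) 0) (isCompact_closedBall (0 : Ed d) L) ?_
  have : Continuous fun q : (Ed d × Ed d) × Ed d => G q.2 q.1.1 :=
    hG.comp (by fun_prop : Continuous fun q : (Ed d × Ed d) × Ed d => (q.2, q.1.1))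
  change Continuous fun q : (Ed d × Ed d) × Ed d =>
    ⟪q.2, q.1.2⟫ - K * ‖q.1.2‖ * max (G q.2 q.1.1 - μ) 0
  fun_prop

theorem Sc_smul {d : ℕ} {G : Ed d → Ed d → ℝ} (hG : Continuous fun q : Ed d × Ed d => G q.1 q.2)
    {L K μ : ℝ} (hL : 0 ≤ L) (x v : Ed d) {s : ℝ} (hs : 0 ≤ s) :
    Sc G L K μ x (s • v) ≤ s * Sc G L K μ x v := by
  refine Sc_le hL fun p hp => ?_
  have := mul_le_mul_of_nonneg_left (le_Sc hG (K := K) (μ := μ) (x := x) (v := v) hp) hs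
  rw [inner_smul_right, norm_smul, Real.norm_eq_abs, abs_of_nonneg hs]
  refine le_trans (le_of_eq ?_) this
  ring

theorem Sc_meas {d : ℕ} {Ω : Type*} [MeasurableSpace Ω] {H : Ed d → Ed d → Ω → ℝ}
    (hHmeas : Measurable fun x : Ed d × Ed d × Ω => H x.1 x.2.1 x.2.2)
    (hHcont : ∀ ω : Ω, Continuous fun q : Ed d × Ed d => H q.1 q.2 ω) {L K μ : ℝ} (hL : 0 ≤ L)
    (x v : Ed d) : Measurable fun ω => Sc (fun p y => H p y ω) L K μ x v := by
  refine measurable_of_Iic fun t => ?_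
  have : Nonempty (Metric.closedBall (0 : Ed d) L) := ⟨⟨0, by simpa using hL⟩⟩
  let D : ℕ → Metric.closedBall (0 : Ed d) L := TopologicalSpace.denseSeq _
  have hD : DenseRange D := TopologicalSpace.denseRange_denseSeq _
  have e : (fun ω => Sc (fun p y => H p y ω) L K μ x v) ⁻¹' Set.Iic t =
      ⋂ n, {ω | ⟪(D n : Ed d), v⟫ - K * ‖v‖ * max (H (D n) x ω - μ) 0 ≤ t} := by
    ext ω
    simp only [Set.mem_preimage, Set.mem_Iic, Set.mem_iInter, Set.mem_ofPred_eq]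
    constructor
    · intro h n
      exact (le_Sc (G := fun p y => H p y ω) (hHcont ω) (mem_closedBall_zero_iff.1 (D n).2)).trans h
    · intro h
      refine Sc_le hL fun p hp => ?_
      have hc : Continuous fun p => H p x ω :=
        (hHcont ω).comp (by fun_prop : Continuous fun p => (p, x))
      have hcl : IsClosed {q : Metric.closedBall (0 : Ed d) L |
          ⟪(q : Ed d), v⟫ - K * ‖v‖ * max (H q x ω - μ) 0 ≤ t} := by
        have : Continuous fun q : Metric.closedBall (0 : Ed d) L => H q x ω :=
          hc.comp continuous_subtype_val
        exact isClosed_le (by fun_prop) continuous_const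
      have := closure_minimal (s := Set.range D) (by rintro _ ⟨n, rfl⟩; exact h n) hcl
      exact this (hD ⟨p, by simpa using hp⟩)
  rw [e]
  refine MeasurableSet.iInter fun n => measurableSet_le ?_ measurable_const
  have : Measurable fun ω => H (D n) x ω :=
    hHmeas.comp (measurable_const.prodMk (measurable_const.prodMk measurable_id))
  fun_prop

theorem Sc_of_sub {d : ℕ} {G : Ed d → Ed d → ℝ} (hG : Continuous fun q : Ed d × Ed d => G q.1 q.2)
    {w : Ed d → ℝ} {C : ℝ≥0} (hw : LipschitzWith C w) {δ μ μ' L : ℝ} (K : ℝ)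
    (hsub : ∀ᵐ y : Ed d, G (gradient w y) y ≤ μ) (hL : ∀ p y, G p y ≤ μ → ‖p‖ ≤ L)
    (huc : ∀ p y y', ‖p‖ ≤ L → ‖y - y'‖ < 2 * δ → G p y ≤ μ → G p y' ≤ μ') (x v : Ed d)
    (hv : ‖v‖ < δ) : w (x + v) - w x ≤ Sc G L K μ' x v := by
  refine line_ineq hw x v _ hv ?_
  filter_upwards [hsub] with z hz hzx
  have h1 := hL _ _ hz
  have h2 := huc _ _ _ h1 hzx hz
  have h3 := le_Sc hG (K := K) (μ := μ') (x := x) (v := v) h1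
  rwa [max_eq_right (by linarith), mul_zero, sub_zero] at h3

theorem exists_p0 {d : ℕ} {G : Ed d → Ed d → ℝ} {w : Ed d → ℝ} {δ μ μ' L : ℝ} (hδ : 0 < δ)
    (hsub : ∀ᵐ y : Ed d, G (gradient w y) y ≤ μ) (hL : ∀ p y, G p y ≤ μ → ‖p‖ ≤ L)
    (huc : ∀ p y y', ‖p‖ ≤ L → ‖y - y'‖ < 2 * δ → G p y ≤ μ → G p y' ≤ μ') (x : Ed d) :
    ∃ p, ‖p‖ ≤ L ∧ G p x ≤ μ' := by
  obtain ⟨z, hz1, hz2⟩ := (Measure.dense_of_ae hsub).exists_dist_lt x (ε := 2 * δ) (by linarith)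
  refine ⟨gradient w z, hL _ _ hz1, huc _ _ _ (hL _ _ hz1) ?_ hz1⟩
  rwa [dist_comm, dist_eq_norm] at hz2

theorem convex_of_mid {d : ℕ} {s : Set (Ed d)} (hs : IsClosed s)
    (hm : ∀ p ∈ s, ∀ q ∈ s, (1/2 : ℝ) • (p + q) ∈ s) : Convex ℝ s := by
  intro p hp q hq a b ha hb hab
  let φ : ℝ → Ed d := fun t => p + t • (q - p)
  have hφ : Continuous φ := by fun_prop
  let T : Set ℝ := φ ⁻¹' s
  have hT : IsClosed T := hs.preimage hφ
  have hTm : ∀ t ∈ T, ∀ u ∈ T, (t + u) / 2 ∈ T := by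
    intro t ht u hu
    have := hm _ ht _ hu
    have e : (1/2 : ℝ) • (φ t + φ u) = φ ((t + u) / 2) := by
      simp only [φ]; module
    rwa [e] at this
  have h0 : (0 : ℝ) ∈ T := by simpa [T, φ] using hp
  have h1 : (1 : ℝ) ∈ T := by simpa [T, φ] using hq
  have hbT : b ∈ T := by
    have hb1 : b ≤ 1 := by linarith
    have hA : IsCompact (T ∩ Set.Icc 0 b) := isCompact_Icc.inter_left hT
    have hB : IsCompact (T ∩ Set.Icc b 1) := isCompact_Icc.inter_left hT
    obtain ⟨α, ⟨hα1, hα2⟩, hα⟩ := hA.exists_isGreatest ⟨0, h0, le_rfl, hb⟩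
    obtain ⟨β, ⟨hβ1, hβ2⟩, hβ⟩ := hB.exists_isLeast ⟨1, h1, hb1, le_rfl⟩
    have hm := hTm _ hα1 _ hβ1
    rcases le_total ((α + β) / 2) b with h | h
    · have := hα ⟨hm, by linarith [hα2.1, hβ2.1], h⟩
      have : α = b := by linarith [hα2.2, hβ2.1]
      rwa [this] at hα1
    · have := hβ ⟨hm, h, by linarith [hα2.2, hβ2.2]⟩
      have : β = b := by linarith [hα2.2, hβ2.1]
      rwa [this] at hβ1
  have e : a • p + b • q = φ b := by
    have : a = 1 - b := by linarith
    simp only [φ, this]; module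
  rw [e]; exact hbT

theorem sub_of_Sc {d : ℕ} {G : Ed d → Ed d → ℝ} (hG : Continuous fun q : Ed d × Ed d => G q.1 q.2)
    {W : Ed d → ℝ} {δ L K μ' ν : ℝ} (hδ : 0 < δ) (hL : 0 ≤ L) (hμν : μ' < ν)
    (hK : 2 * L ≤ K * (ν - μ')) (hK0 : 0 ≤ K) {x : Ed d} (hd : DifferentiableAt ℝ W x)
    (hW : ∀ v, ‖v‖ < δ → W (x + v) - W x ≤ Sc G L K μ' x v)
    (hp0 : ∃ p, ‖p‖ ≤ L ∧ G p x ≤ μ')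
    (hqc : ∀ p q, G ((1/2 : ℝ) • (p + q)) x ≤ max (G p x) (G q x)) :
    G (gradient W x) x ≤ ν := by
  by_contra hcon
  obtain ⟨p0, hp0L, hp0⟩ := hp0
  have hGx : Continuous fun p => G p x := hG.comp (by fun_prop : Continuous fun p => (p, x))
  have hcl : IsClosed {p | G p x ≤ ν} := isClosed_le hGx continuous_const
  have hcv : Convex ℝ {p | G p x ≤ ν} :=
    convex_of_mid hcl fun p hp q hq => (hqc p q).trans (max_le hp hq)
  obtain ⟨f, u, hf1, hf2⟩ := geometric_hahn_banach_closed_point hcv hcl hcon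
  set v : Ed d := (InnerProductSpace.toDual ℝ (Ed d)).symm f with hv
  have hfv : ∀ p, f p = ⟪p, v⟫ := by
    intro p
    rw [real_inner_comm, hv, InnerProductSpace.toDual_symm_apply]
  have hS : Sc G L K μ' x v ≤ u := by
    refine Sc_le hL fun p hp => ?_
    by_cases hpν : G p x ≤ ν
    · have h1 := hf1 p hpν
      rw [hfv] at h1
      have : 0 ≤ K * ‖v‖ * max (G p x - μ') 0 := by positivity
      linarith
    · push Not at hpν
      have h1 := hf1 p0 (hp0.trans hμν.le)
      rw [hfv] at h1
      have h2 := real_inner_le_norm p v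
      have h3 := (abs_le.1 (abs_real_inner_le_norm p0 v)).1
      have h4 : 2 * L * ‖v‖ ≤ K * ‖v‖ * max (G p x - μ') 0 := by
        have : K * (ν - μ') ≤ K * max (G p x - μ') 0 := by
          refine mul_le_mul_of_nonneg_left (le_trans ?_ (le_max_left _ _)) hK0
          linarith
        nlinarith [norm_nonneg v]
      have h5 : ‖p‖ * ‖v‖ ≤ L * ‖v‖ := by gcongr
      have h6 : ‖p0‖ * ‖v‖ ≤ L * ‖v‖ := by gcongr
      linarith
  have hder : HasDerivAt (fun t : ℝ => W (x + t • v)) ⟪gradient W x, v⟫ 0 := by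
    have h1 : HasFDerivAt W (InnerProductSpace.toDual ℝ (Ed d) (gradient W x)) (x + (0:ℝ) • v) := by
      rw [zero_smul, add_zero]
      exact hd.hasGradientAt.hasFDerivAt
    have h2 : HasDerivAt (fun t : ℝ => x + t • v) v 0 := by
      simpa using ((hasDerivAt_id (0:ℝ)).smul_const v).const_add x
    have h3 := h1.comp_hasDerivAt 0 h2
    rw [InnerProductSpace.toDual_apply_apply] at h3
    exact h3
  have hlim := hder.tendsto_slope_zero_right
  have hle : ⟪gradient W x, v⟫ ≤ u := by
    refine le_of_tendsto hlim ?_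
    have hsm : ∀ᶠ t : ℝ in 𝓝[>] 0, ‖t • v‖ < δ := by
      have : Tendsto (fun t : ℝ => ‖t • v‖) (𝓝[>] 0) (𝓝 ‖(0:ℝ) • v‖) :=
        (Continuous.tendsto (by fun_prop : Continuous fun t : ℝ => ‖t • v‖) 0).mono_left
          nhdsWithin_le_nhds
      exact this.eventually (gt_mem_nhds (by simpa using hδ))
    filter_upwards [hsm, self_mem_nhdsWithin] with t ht ht0
    have ht0 : 0 < t := ht0
    have h1 := hW _ ht
    have h2 := Sc_smul hG hL x v ht0.le (K := K) (μ := μ')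
    have h3 : t * Sc G L K μ' x v ≤ t * u := by gcongr
    simp only [zero_add, zero_smul, add_zero, smul_eq_mul]
    rw [inv_mul_le_iff₀ ht0]
    linarith
  rw [hfv] at hf2
  linarith

/-! ### Probabilistic part -/

theorem net_lemma {d : ℕ} {F : Ed d → ℝ} {L : ℝ} {p : Ed d} (hL : 0 ≤ L) (hp : ‖p‖ ≤ L)
    (hlip : ∀ x y, F y ≤ F x + L * ‖y - x‖) {D : ℕ → Ed d} (hD : DenseRange D)
    (h : ∀ i j : ℕ, ∃ N : ℕ, ∀ n ≥ N, (n : ℝ) * (⟪p, D i⟫ - 1 / ((j : ℝ) + 1)) ≤ F ((n : ℝ) • D i))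
    (ε : ℝ) (hε : 0 < ε) : ∃ R : ℝ, ∀ y, R ≤ ‖y‖ → ⟪p, y⟫ - ε * ‖y‖ ≤ F y := by
  set η : ℝ := ε / (2 * (2 * L + 1)) with hη
  have hη0 : 0 < η := by positivity
  have hηe : η * (2 * L + 1) = ε / 2 := by rw [hη]; field_simp
  obtain ⟨j, hj⟩ := exists_nat_one_div_lt hη0
  choose N hN using fun i => h i j
  obtain ⟨t, ht⟩ := (isCompact_sphere (0 : Ed d) 1).elim_finite_subcover
    (fun i => Metric.ball (D i) η) (fun i => Metric.isOpen_ball) (by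
      intro u _
      obtain ⟨i, hi⟩ := hD.exists_dist_lt u hη0
      exact Set.mem_iUnion.2 ⟨i, hi⟩)
  refine ⟨max (max ((∑ i ∈ t, N i : ℕ) + 1 : ℝ) (4 * L / ε)) 1, fun y hy => ?_⟩
  have hy1 : ((∑ i ∈ t, N i : ℕ) : ℝ) + 1 ≤ ‖y‖ :=
    ((le_max_left _ _).trans (le_max_left _ _)).trans hy
  have hy2 : 4 * L / ε ≤ ‖y‖ := ((le_max_right _ _).trans (le_max_left _ _)).trans hy
  have hy3 : 1 ≤ ‖y‖ := (le_max_right _ _).trans hy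
  have hy0 : 0 < ‖y‖ := by linarith
  rw [div_le_iff₀ hε] at hy2
  set u : Ed d := ‖y‖⁻¹ • y with hu
  have hun : ‖u‖ = 1 := by
    rw [hu, norm_smul, norm_inv, norm_norm]; field_simp
  have hyu : y = ‖y‖ • u := by rw [hu, smul_smul, mul_inv_cancel₀ hy0.ne', one_smul]
  clear_value u
  obtain ⟨i, hi⟩ := Set.mem_iUnion.1 (ht (mem_sphere_zero_iff_norm.2 hun))
  obtain ⟨hit, hi⟩ := Set.mem_iUnion.1 hi
  rw [Metric.mem_ball, dist_eq_norm] at hi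
  set n : ℕ := ⌊‖y‖⌋₊ with hn
  have hn1 : (n : ℝ) ≤ ‖y‖ := Nat.floor_le hy0.le
  have hn2 : ‖y‖ < n + 1 := Nat.lt_floor_add_one _
  have hnN : N i ≤ n := by
    refine (Finset.single_le_sum (f := N) (fun _ _ => Nat.zero_le _) hit).trans ?_
    apply Nat.le_floor
    linarith
  have h1 := hN i n hnN
  have h2 := hlip y ((n : ℝ) • D i)
  have e1 : ‖(n : ℝ) • D i - y‖ ≤ 1 + n * η := by
    have : (n : ℝ) • D i - y = -((‖y‖ - n) • u + (n : ℝ) • (u - D i)) := by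
      conv_lhs => rw [hyu]
      module
    rw [this, norm_neg]
    refine (norm_add_le _ _).trans ?_
    rw [norm_smul, norm_smul, hun, Real.norm_of_nonneg (by linarith), Real.norm_natCast]
    have : (n : ℝ) * ‖u - D i‖ ≤ n * η := by gcongr
    linarith
  have e2 : ⟪p, u⟫ - L * η ≤ ⟪p, D i⟫ := by
    have := real_inner_le_norm p (u - D i)
    rw [inner_sub_right] at this
    have h3 : ‖p‖ * ‖u - D i‖ ≤ L * η := by gcongr
    linarith
  have e3 : ⟪p, y⟫ - L ≤ n * ⟪p, u⟫ := by
    have e : ⟪p, y⟫ = ‖y‖ * ⟪p, u⟫ := by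
      conv_lhs => rw [hyu, inner_smul_right]
    have h4 := real_inner_le_norm p u
    rw [hun, mul_one] at h4
    rw [e]
    have : (‖y‖ - n) * ⟪p, u⟫ ≤ (‖y‖ - n) * L :=
      mul_le_mul_of_nonneg_left (h4.trans hp) (by linarith)
    nlinarith
  have e4 : (n : ℝ) * (⟪p, u⟫ - L * η - η) ≤ n * (⟪p, D i⟫ - 1 / ((j : ℝ) + 1)) := by
    gcongr
  have e5 : L * ‖(n : ℝ) • D i - y‖ ≤ L * (1 + n * η) := by gcongr
  have e6 : (n : ℝ) * (η * (2 * L + 1)) ≤ ‖y‖ * (ε / 2) := by rw [hηe]; gcongr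
  nlinarith

theorem dir_lemma {d : ℕ} {Ω : Type*} [MeasurableSpace Ω] {P : Measure Ω} [IsProbabilityMeasure P]
    {τ : Ed d → Ω → Ω} (hτmp : ∀ y : Ed d, MeasurePreserving (τ y) P P)
    (hτgrp : ∀ x y : Ed d, τ (x + y) = τ x ∘ τ y) (hτzero : τ 0 = id)
    (hτerg : ∀ A : Set Ω, MeasurableSet A → (∀ z : Ed d, τ z ⁻¹' A = A) → P A = 0 ∨ P A = 1)
    {c : Ω → Ed d → Ed d → ℝ} {δ L : ℝ} (hδ : 0 < δ) (hL : 0 ≤ L)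
    (hc : ∀ ω x v, c ω x v ≤ L * ‖v‖)
    (hcc : ∀ ω, Continuous fun q : Ed d × Ed d => c ω q.1 q.2)
    (hcm : ∀ x v, Measurable fun ω => c ω x v)
    (hst : ∀ z ω, c (τ z ω) = fun a v => c ω (a + z) v)
    (hgood : ∀ᵐ ω ∂P, GoodC (c ω) δ)
    (hMm : ∀ y, Measurable fun ω => Mm (c ω) δ L y) (y : Ed d) {a b : ℝ} (hab : a < b)
    (hb : ∀ n : ℕ, b * n ≤ ∫ ω, Mm (c ω) δ L ((n : ℝ) • y) ∂P) :
    ∀ᵐ ω ∂P, ∃ N : ℕ, ∀ n ≥ N, (n : ℝ) * a ≤ Mm (c ω) δ L ((n : ℝ) • y) := by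
  let A : Set Ω := {ω | ∀ k N : ℕ, ∃ n ≥ N, ∃ s < (n : ℝ) * (a + 1 / ((k : ℝ) + 1)),
    Ch (c ω) δ 0 ((n : ℝ) • y) s}
  have hAm : MeasurableSet A := by
    have : A = ⋂ k : ℕ, ⋂ N : ℕ, ⋃ n : ℕ, ⋃ _ : n ≥ N,
        {ω | ∃ s < (n : ℝ) * (a + 1 / ((k : ℝ) + 1)), Ch (c ω) δ 0 ((n : ℝ) • y) s} := by
      ext ω; simp [A]
    rw [this]
    exact MeasurableSet.iInter fun k => MeasurableSet.iInter fun N => MeasurableSet.iUnion fun n =>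
      MeasurableSet.iUnion fun _ => Ch.measurable δ hcc hcm _ _ _
  have hinv1 : ∀ z ω, ω ∈ A → τ z ω ∈ A := by
    intro z ω hω k N
    obtain ⟨m, hm⟩ := exists_nat_gt (2 * L * ‖z‖ * (2 * ((k : ℝ) + 1)))
    obtain ⟨n, hn, s, hs, hch⟩ := hω (2 * k + 1) (max N m)
    obtain ⟨t1, ht1, h1⟩ := Ch.line hδ (hc ω) z 0
    obtain ⟨t2, ht2, h2⟩ := Ch.line hδ (hc ω) ((n : ℝ) • y) ((n : ℝ) • y + z)
    refine ⟨n, (le_max_left _ _).trans hn, t1 + s + t2, ?_, ?_⟩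
    · have hmn : (m : ℝ) ≤ n := by exact_mod_cast (le_max_right _ _).trans hn
      have e1 : (n : ℝ) * (1 / ((k : ℝ) + 1)) =
          2 * ((n : ℝ) * (1 / (((2 * k + 1 : ℕ) : ℝ) + 1))) := by
        push_cast; field_simp; ring
      have e2 : 2 * L * ‖z‖ ≤ (n : ℝ) * (1 / (((2 * k + 1 : ℕ) : ℝ) + 1)) := by
        push_cast
        rw [mul_one_div, le_div_iff₀ (by positivity)]
        linarith
      simp only [zero_sub, norm_neg, add_sub_cancel_left] at ht1 ht2
      nlinarith
    · have h3 := (h1.trans hch).trans h2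
      rw [hst]
      exact Ch.unshift (by simpa using h3)
  have hinv : ∀ z, τ z ⁻¹' A = A := by
    intro z
    ext ω
    refine ⟨fun h => ?_, hinv1 z ω⟩
    have := hinv1 (-z) _ h
    have e : τ (-z) (τ z ω) = ω := by
      have := congrFun (hτgrp (-z) z) ω
      rw [neg_add_cancel, hτzero] at this
      exact this.symm
    rwa [e] at this
  rcases hτerg A hAm hinv with h0 | h1
  · have : ∀ᵐ ω ∂P, ω ∉ A := by rw [ae_iff]; simpa using h0
    filter_upwards [this] with ω hω
    simp only [A, Set.mem_ofPred_eq] at hω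
    push Not at hω
    obtain ⟨k, N, hkN⟩ := hω
    refine ⟨N, fun n hn => ?_⟩
    by_contra! hlt
    obtain ⟨-, s, hs, hch⟩ := (Mm_lt_iff hδ (hc ω) _ _).1 hlt
    refine hkN n hn s (hs.trans_le ?_) hch
    gcongr
    have : (0 : ℝ) ≤ 1 / ((k : ℝ) + 1) := by positivity
    linarith
  · exfalso
    have hA1 : ∀ᵐ ω ∂P, ω ∈ A := by
      rw [← mem_ae_iff_prob_eq_one hAm] at h1
      exact h1
    have hit : ∀ m : ℕ, (τ y)^[m] = τ ((m : ℝ) • y) := by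
      intro m
      induction m with
      | zero => simp [hτzero]
      | succ m ih =>
        rw [Function.iterate_succ, ih, ← hτgrp]
        congr 1; push_cast; module
    have hGsh : ∀ z ω, GoodC (c ω) δ → GoodC (c (τ z ω)) δ := by
      intro z ω h
      rw [hst]; exact h.shift z
    refine absurd hab (not_lt.2 ?_)
    refine kw_lower (hτmp y) (𝒢 := {ω | GoodC (c ω) δ}) (fun ω h => hGsh y ω h) hgood
      (g := fun n ω => Mm (c ω) δ L ((n : ℝ) • y)) (L := L * ‖y‖) (by positivity)
      (fun n => hMm _) ?_ ?_ ?_ hb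
    · intro ω hω m n
      have := Mm_add hδ (hc ω) hω ((m : ℝ) • y) ((n : ℝ) • y)
      simp only [hit, hst]
      rw [← add_smul] at this
      push_cast
      exact this
    · intro ω hω n
      have e : L * ‖(n : ℝ) • y‖ = L * ‖y‖ * n := by
        rw [norm_smul, Real.norm_natCast]; ring
      rw [abs_le, ← e]
      exact ⟨Mm_ge hδ (hc ω) _, Mm_le_norm hδ hL (hc ω) _⟩
    · filter_upwards [hA1, hgood] with ω hω hg ε hε
      obtain ⟨k, hk⟩ := exists_nat_one_div_lt hε
      obtain ⟨n, hn, s, hs, hch⟩ := hω k 1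
      refine ⟨n, hn, (Mm_le hδ (hc ω) hg hch).trans (hs.le.trans ?_)⟩
      gcongr

theorem metric_p {d : ℕ} {Ω : Type*} [MeasurableSpace Ω] {P : Measure Ω} [IsProbabilityMeasure P]
    {τ : Ed d → Ω → Ω} (hτmp : ∀ y : Ed d, MeasurePreserving (τ y) P P)
    (hτgrp : ∀ x y : Ed d, τ (x + y) = τ x ∘ τ y) (hτzero : τ 0 = id)
    (hτerg : ∀ A : Set Ω, MeasurableSet A → (∀ z : Ed d, τ z ⁻¹' A = A) → P A = 0 ∨ P A = 1)
    {c : Ω → Ed d → Ed d → ℝ} {δ L : ℝ} (hδ : 0 < δ) (hL : 0 ≤ L)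
    (hc : ∀ ω x v, c ω x v ≤ L * ‖v‖)
    (hcc : ∀ ω, Continuous fun q : Ed d × Ed d => c ω q.1 q.2)
    (hcm : ∀ x v, Measurable fun ω => c ω x v)
    (hst : ∀ z ω, c (τ z ω) = fun a v => c ω (a + z) v)
    (hgood : ∀ᵐ ω ∂P, GoodC (c ω) δ) :
    ∃ p : Ed d, ‖p‖ ≤ L ∧ ∀ᵐ ω ∂P, ∀ ε : ℝ, 0 < ε → ∃ R : ℝ, ∀ y, R ≤ ‖y‖ →
      ⟪p, y⟫ - ε * ‖y‖ ≤ Mm (c ω) δ L y := by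
  have hMm : ∀ y, Measurable fun ω => Mm (c ω) δ L y := by
    intro y
    refine measurable_of_Iio fun t => ?_
    have : (fun ω => Mm (c ω) δ L y) ⁻¹' Set.Iio t =
        {ω | -(L * ‖y‖) < t} ∩ {ω | ∃ s < t, Ch (c ω) δ 0 y s} := by
      ext ω
      simp only [Set.mem_preimage, Set.mem_Iio, Set.mem_inter_iff, Set.mem_ofPred_eq]
      exact Mm_lt_iff hδ (hc ω) y t
    rw [this]
    exact (MeasurableSet.const _).inter (Ch.measurable δ hcc hcm _ _ _)
  have hMi : ∀ y, Integrable (fun ω => Mm (c ω) δ L y) P := by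
    intro y
    refine Integrable.of_bound (hMm y).aestronglyMeasurable (L * ‖y‖)
      (Eventually.of_forall fun ω => ?_)
    rw [Real.norm_eq_abs, abs_le]
    exact ⟨Mm_ge hδ (hc ω) _, Mm_le_norm hδ hL (hc ω) _⟩
  set h : Ed d → ℝ := fun y => ∫ ω, Mm (c ω) δ L y ∂P with hh
  have hadd : ∀ x y, h (x + y) ≤ h x + h y := by
    intro x y
    have e : h y = ∫ ω, Mm (c (τ x ω)) δ L y ∂P := by
      have := integral_map (μ := P) (φ := τ x) (hτmp x).measurable.aemeasurable
        (f := fun ω => Mm (c ω) δ L y) (hMm y).aestronglyMeasurable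
      rw [(hτmp x).map_eq] at this
      exact this
    have hi : Integrable (fun ω => Mm (c (τ x ω)) δ L y) P :=
      (hτmp x).integrable_comp_of_integrable (hMi y)
    rw [e, hh, ← integral_add (hMi x) hi]
    refine integral_mono_ae (hMi _) ((hMi x).add hi) ?_
    filter_upwards [hgood] with ω hω
    rw [hst]
    exact Mm_add hδ (hc ω) hω x y
  have hlip : ∀ x y, h y ≤ h x + L * ‖y - x‖ := by
    intro x y
    have e : h x + L * ‖y - x‖ = ∫ ω, (Mm (c ω) δ L x + L * ‖y - x‖) ∂P := by
      rw [integral_add (hMi x) (integrable_const _)]; simp [hh]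
    rw [e]
    refine integral_mono_ae (hMi _) ((hMi x).add (integrable_const _)) ?_
    filter_upwards [hgood] with ω hω
    exact Mm_lip hδ (hc ω) hω x y
  obtain ⟨p, hp⟩ := hb_lemma hL hadd hlip
  have hpL : ‖p‖ ≤ L := by
    have h1 := hp p
    have h2 : h p ≤ L * ‖p‖ := by
      have := integral_mono (μ := P) (hMi p) (integrable_const (L * ‖p‖))
        fun ω => Mm_le_norm hδ hL (hc ω) p
      simpa using this
    rw [real_inner_self_eq_norm_sq] at h1
    by_contra! hlt
    nlinarith [norm_nonneg p]
  refine ⟨p, hpL, ?_⟩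
  let D : ℕ → Ed d := TopologicalSpace.denseSeq (Ed d)
  have hall : ∀ᵐ ω ∂P, ∀ i j : ℕ, ∃ N : ℕ, ∀ n ≥ N,
      (n : ℝ) * (⟪p, D i⟫ - 1 / ((j : ℝ) + 1)) ≤ Mm (c ω) δ L ((n : ℝ) • D i) := by
    rw [ae_all_iff]; intro i
    rw [ae_all_iff]; intro j
    refine dir_lemma hτmp hτgrp hτzero hτerg hδ hL hc hcc hcm hst hgood hMm (D i)
      (b := ⟪p, D i⟫) ?_ ?_
    · have : (0 : ℝ) < 1 / ((j : ℝ) + 1) := by positivity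
      linarith
    · intro n
      have := hp ((n : ℝ) • D i)
      rw [inner_smul_right] at this
      linarith
  filter_upwards [hall, hgood] with ω h1 hg
  exact fun ε hε => net_lemma hL hpL (Mm_lip hδ (hc ω) hg)
    (TopologicalSpace.denseRange_denseSeq _) h1 ε hε

/-! ### Final assembly -/

theorem grad_bound {d : ℕ} {w : Ed d → ℝ} {C : ℝ≥0} (hw : LipschitzWith C w) (y : Ed d) :
    ‖gradient w y‖ ≤ C := by
  rw [gradient, LinearIsometryEquiv.norm_map]
  exact norm_fderiv_le_of_lipschitz ℝ hw

/-- common form of the inf-sup quantities -/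
def InfSup {d : ℕ} (𝒲 : Set (Ed d → ℝ)) (G : Ed d → Ed d → ℝ) (p : Ed d) : ℝ :=
  sInf {t | ∃ w ∈ 𝒲, t = essSup (fun y => G (p + gradient w y) y) volume}

theorem lip_bdd {d : ℕ} {G : Ed d → Ed d → ℝ}
    (hb : ∀ R : ℝ, 0 < R → ∃ M : ℝ, ∀ p y : Ed d, ‖p‖ ≤ R → |G p y| ≤ M) (p : Ed d)
    {w : Ed d → ℝ} (hw : w ∈ LipFuns d) : ∃ M : ℝ, ∀ y, |G (p + gradient w y) y| ≤ M := by
  obtain ⟨C, hC⟩ := hw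
  obtain ⟨M, hM⟩ := hb (‖p‖ + C + 1) (by positivity)
  refine ⟨M, fun y => hM _ _ ?_⟩
  linarith [norm_add_le p (gradient w y), grad_bound hC y]

theorem InfSup_le {d : ℕ} {𝒲 : Set (Ed d → ℝ)} (h𝒲 : 𝒲 ⊆ LipFuns d) {G : Ed d → Ed d → ℝ}
    (hb : ∀ R : ℝ, 0 < R → ∃ M : ℝ, ∀ p y : Ed d, ‖p‖ ≤ R → |G p y| ≤ M)
    {B : ℝ} (hB : ∀ p y, B ≤ G p y) {p : Ed d} {w : Ed d → ℝ} (hw : w ∈ 𝒲) {ν : ℝ}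
    (h : ∀ᵐ y : Ed d, G (p + gradient w y) y ≤ ν) : InfSup 𝒲 G p ≤ ν := by
  have hco : ∀ f : Ed d → ℝ, (∀ y, B ≤ f y) →
      IsCoboundedUnder (· ≤ ·) (ae (volume : Measure (Ed d))) f := fun f hf =>
    (isBoundedUnder_of ⟨B, hf⟩ : IsBoundedUnder (· ≥ ·) _ f).isCoboundedUnder_flip
  have hbd : BddBelow {t | ∃ w ∈ 𝒲, t = essSup (fun y => G (p + gradient w y) y) volume} := by
    refine ⟨B, ?_⟩
    rintro _ ⟨w', hw', rfl⟩
    obtain ⟨M, hM⟩ := lip_bdd hb p (h𝒲 hw')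
    refine le_limsup_of_frequently_le (Frequently.of_forall fun y => hB _ _) ?_
    exact isBoundedUnder_of ⟨M, fun y => (abs_le.1 (hM y)).2⟩
  exact (csInf_le hbd ⟨w, hw, rfl⟩).trans (limsup_le_of_le (hco _ fun y => hB _ _) h)

theorem InfSup_lt {d : ℕ} {𝒲 : Set (Ed d → ℝ)} (h𝒲 : 𝒲 ⊆ LipFuns d) (h0 : (fun _ => 0) ∈ 𝒲)
    {G : Ed d → Ed d → ℝ}
    (hb : ∀ R : ℝ, 0 < R → ∃ M : ℝ, ∀ p y : Ed d, ‖p‖ ≤ R → |G p y| ≤ M)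
    {p : Ed d} {ν : ℝ} (h : InfSup 𝒲 G p < ν) :
    ∃ w ∈ 𝒲, ∀ᵐ y : Ed d, G (p + gradient w y) y ≤ ν := by
  obtain ⟨_, ⟨w, hw, rfl⟩, hlt⟩ := exists_lt_of_csInf_lt (by exact ⟨_, _, h0, rfl⟩) h
  obtain ⟨M, hM⟩ := lip_bdd hb p (h𝒲 hw)
  refine ⟨w, hw, ?_⟩
  filter_upwards [ae_lt_of_essSup_lt hlt
    (isBoundedUnder_of ⟨M, fun y => (abs_le.1 (hM y)).2⟩)] with y hy
  exact hy.le

theorem SL_sub (d : ℕ) : SLplus d ⊆ LipFuns d := fun _ h => h.1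

theorem zero_Lip (d : ℕ) : (fun _ => 0) ∈ LipFuns d := ⟨0, LipschitzWith.const 0⟩

theorem zero_SL (d : ℕ) : (fun _ => 0) ∈ SLplus d :=
  ⟨zero_Lip d, fun ε hε => ⟨0, fun y _ => by simpa using hε.le⟩⟩

theorem HbarPlusOm_eq {d : ℕ} {Ω : Type*} (H : Ed d → Ed d → Ω → ℝ) (p : Ed d) (ω : Ω) :
    HbarPlusOm d H p ω = InfSup (SLplus d) (fun p y => H p y ω) p := rfl

theorem HstarOm_eq {d : ℕ} {Ω : Type*} (H : Ed d → Ed d → Ω → ℝ) (ω : Ω) :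
    HstarOm d H ω = InfSup (LipFuns d) (fun p y => H p y ω) 0 := by
  simp only [HstarOm, InfSup, zero_add]

theorem grad_add_inner {d : ℕ} {w : Ed d → ℝ} {y : Ed d} (hw : DifferentiableAt ℝ w y) (p : Ed d) :
    gradient (fun y => w y + ⟪p, y⟫) y = p + gradient w y := by
  have h1 := hw.hasGradientAt.hasFDerivAt
  have h2 : HasFDerivAt (fun y : Ed d => ⟪p, y⟫) (InnerProductSpace.toDual ℝ (Ed d) p) y :=
    (InnerProductSpace.toDual ℝ (Ed d) p).hasFDerivAt
  have h3 := h1.add h2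
  rw [← map_add] at h3
  have h4 : HasGradientAt (fun y => w y + ⟪p, y⟫) (gradient w y + p) y := h3
  rw [h4.gradient, add_comm]

theorem lip_add_inner {d : ℕ} {w : Ed d → ℝ} (hw : w ∈ LipFuns d) (p : Ed d) :
    (fun y => w y + ⟪p, y⟫) ∈ LipFuns d := by
  obtain ⟨C, hC⟩ := hw
  exact ⟨_, hC.add (InnerProductSpace.toDual ℝ (Ed d) p).lipschitz⟩

theorem key {d : ℕ} {Ω : Type*} [MeasurableSpace Ω] {P : Measure Ω} [IsProbabilityMeasure P]
    {τ : Ed d → Ω → Ω} (hτmp : ∀ y : Ed d, MeasurePreserving (τ y) P P)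
    (hτgrp : ∀ x y : Ed d, τ (x + y) = τ x ∘ τ y) (hτzero : τ 0 = id)
    (hτerg : ∀ A : Set Ω, MeasurableSet A → (∀ z : Ed d, τ z ⁻¹' A = A) → P A = 0 ∨ P A = 1)
    {H : Ed d → Ed d → Ω → ℝ}
    (hHmeas : Measurable fun x : Ed d × Ed d × Ω => H x.1 x.2.1 x.2.2)
    (hHstat : ∀ (p y z : Ed d) (ω : Ω), H p y (τ z ω) = H p (y + z) ω)
    (hHcont : ∀ ω : Ω, Continuous fun q : Ed d × Ed d => H q.1 q.2 ω)
    (hreg_uc : ∀ R : ℝ, 0 < R → ∀ ε : ℝ, 0 < ε → ∃ δ : ℝ, 0 < δ ∧ ∀ (ω : Ω) (p p' y y' : Ed d),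
      ‖p‖ ≤ R → ‖p'‖ ≤ R → ‖p - p'‖ < δ → ‖y - y'‖ < δ → |H p y ω - H p' y' ω| < ε)
    (hqc : ∀ (ω : Ω) (p q y : Ed d), H ((1/2 : ℝ) • (p + q)) y ω ≤ max (H p y ω) (H q y ω))
    {Hs ν L : ℝ} (hν : Hs < ν) (hL0 : 0 < L) (hL : ∀ ω p y, H p y ω ≤ ν → ‖p‖ ≤ L)
    (hw : ∀ μ, Hs < μ → ∀ᵐ ω ∂P, ∃ w ∈ LipFuns d, ∀ᵐ y : Ed d, H (gradient w y) y ω ≤ μ) :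
    ∃ p : Ed d, ‖p‖ ≤ L ∧ ∀ᵐ ω ∂P, ∃ w ∈ SLplus d, ∀ᵐ y : Ed d, H (p + gradient w y) y ω ≤ ν := by
  obtain ⟨μ', hμ'1, hμ'ν⟩ := exists_between hν
  obtain ⟨μ, hμ1, hμμ'⟩ := exists_between hμ'1
  obtain ⟨δ₀, hδ₀, huc₀⟩ := hreg_uc L hL0 (μ' - μ) (by linarith)
  set δ := δ₀ / 2 with hδd
  have hδ : 0 < δ := by positivity
  have huc : ∀ ω p y y', ‖p‖ ≤ L → ‖y - y'‖ < 2 * δ → H p y ω ≤ μ → H p y' ω ≤ μ' := by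
    intro ω p y y' hp hy hle
    have := huc₀ ω p p y y' hp hp (by simpa using hδ₀) (by linarith)
    rw [abs_lt] at this
    linarith [this.1]
  have hLμ : ∀ ω p y, H p y ω ≤ μ → ‖p‖ ≤ L := fun ω p y h => hL ω p y (by linarith)
  set K := 2 * L / (ν - μ') with hKd
  have hνμ : 0 < ν - μ' := by linarith
  have hK0 : 0 ≤ K := by positivity
  have hK : 2 * L ≤ K * (ν - μ') := by rw [hKd, div_mul_cancel₀ _ hνμ.ne']
  set c : Ω → Ed d → Ed d → ℝ := fun ω => Sc (fun p y => H p y ω) L K μ' with hcd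
  have hc : ∀ ω x v, c ω x v ≤ L * ‖v‖ := fun ω x v => Sc_le_norm hL0.le hK0 x v
  have hst : ∀ z ω, c (τ z ω) = fun a v => c ω (a + z) v := by
    intro z ω
    funext a v
    simp only [hcd, Sc, hHstat]
  have hgood : ∀ᵐ ω ∂P, GoodC (c ω) δ := by
    filter_upwards [hw μ hμ1] with ω hω
    obtain ⟨w, ⟨C, hC⟩, hsub⟩ := hω
    exact ⟨w, fun x v hv => Sc_of_sub (hHcont ω) hC K hsub (hLμ ω) (huc ω) x v hv⟩
  obtain ⟨p, hpL, hp⟩ := metric_p hτmp hτgrp hτzero hτerg hδ hL0.le hc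
    (fun ω => Sc_cont (hHcont ω) L K μ') (fun x v => Sc_meas hHmeas hHcont hL0.le x v) hst hgood
  refine ⟨p, hpL, ?_⟩
  filter_upwards [hp, hgood, hw μ hμ1] with ω hω hg hwω
  obtain ⟨w, -, hsub⟩ := hwω
  set W : Ed d → ℝ := Mm (c ω) δ L with hWd
  have hWlip : LipschitzWith ⟨L, hL0.le⟩ W := by
    refine LipschitzWith.of_le_add_mul _ fun x y => ?_
    rw [dist_eq_norm]
    exact Mm_lip hδ (hc ω) hg y x
  have hW : W ∈ LipFuns d := ⟨_, hWlip⟩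
  refine ⟨fun y => W y + ⟪-p, y⟫, ⟨lip_add_inner hW _, ?_⟩, ?_⟩
  · intro ε hε
    obtain ⟨R, hR⟩ := hω ε hε
    refine ⟨max R 1, fun y hy => ?_⟩
    have h1 := hR y ((le_max_left _ _).trans hy)
    have h2 : 0 < ‖y‖ := lt_of_lt_of_le one_pos ((le_max_right _ _).trans hy)
    rw [le_div_iff₀ h2]
    change -ε * ‖y‖ ≤ W y + ⟪-p, y⟫
    rw [inner_neg_left]
    linarith
  · filter_upwards [hWlip.ae_differentiableAt] with y hy
    rw [grad_add_inner hy, add_neg_cancel_left]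
    refine sub_of_Sc (G := fun p y => H p y ω) (hHcont ω) hδ hL0.le hμ'ν hK hK0 hy (fun v hv => ?_)
      (exists_p0 hδ hsub (hLμ ω) (huc ω) y) (fun p q => hqc ω p q y)
    have := Mm_trans hδ (hc ω) hg (Ch.one y v hv)
    linarith

/-- H̄* is the attained minimum of H̄₊. -/
theorem statement_15
    (d : ℕ) (hd : 0 < d)
    {Ω : Type*} [MeasurableSpace Ω] (P : Measure Ω) [IsProbabilityMeasure P]
    (τ : Ed d → Ω → Ω)
    (hτmeas : ∀ y : Ed d, Measurable (τ y))
    (hτmp : ∀ y : Ed d, MeasurePreserving (τ y) P P)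
    (hτgrp : ∀ x y : Ed d, τ (x + y) = τ x ∘ τ y)
    (hτzero : τ 0 = id)
    (hτerg : ∀ A : Set Ω, MeasurableSet A → (∀ z : Ed d, τ z ⁻¹' A = A) → P A = 0 ∨ P A = 1)
    (H : Ed d → Ed d → Ω → ℝ)
    (hHmeas : Measurable fun x : Ed d × Ed d × Ω => H x.1 x.2.1 x.2.2)
    (hHstat : ∀ (p y z : Ed d) (ω : Ω), H p y (τ z ω) = H p (y + z) ω)
    (hHcont : ∀ ω : Ω, Continuous fun q : Ed d × Ed d => H q.1 q.2 ω)
    (hreg_bdd : ∀ R : ℝ, 0 < R → ∃ M : ℝ, ∀ (ω : Ω) (p y : Ed d), ‖p‖ ≤ R → |H p y ω| ≤ M)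
    (hreg_uc : ∀ R : ℝ, 0 < R → ∀ ε : ℝ, 0 < ε → ∃ δ : ℝ, 0 < δ ∧ ∀ (ω : Ω) (p p' y y' : Ed d),
      ‖p‖ ≤ R → ‖p'‖ ≤ R → ‖p - p'‖ < δ → ‖y - y'‖ < δ → |H p y ω - H p' y' ω| < ε)
    (hcoer : ∀ M : ℝ, ∃ R : ℝ, ∀ (ω : Ω) (p y : Ed d), R ≤ ‖p‖ → M ≤ H p y ω)
    (hqc : ∀ (ω : Ω) (p q y : Ed d), H ((1/2 : ℝ) • (p + q)) y ω ≤ max (H p y ω) (H q y ω))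
    (Λ : ℝ → ℝ → ℝ)
    (hΛcont : Continuous fun m : ℝ × ℝ => Λ m.1 m.2)
    (hΛmono : ∀ a b a' b' : ℝ, a ≤ a' → b ≤ b' → Λ a b ≤ Λ a' b')
    (hΛstrict : ∀ a b : ℝ, a ≠ b → Λ a b < max a b)
    (hsqc : ∀ (ω : Ω) (p q y : Ed d), H ((1/2 : ℝ) • (p + q)) y ω ≤ Λ (H p y ω) (H q y ω))
    (HbarP : Ed d → ℝ) (hHbarP : ∀ p : Ed d, ∀ᵐ ω ∂P, HbarPlusOm d H p ω = HbarP p)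
    (Hs : ℝ) (hHs : ∀ᵐ ω ∂P, HstarOm d H ω = Hs) :
    (∃ p : Ed d, HbarP p = Hs) ∧ ∀ p : Ed d, Hs ≤ HbarP p := by
  obtain ⟨B, hB⟩ : ∃ B : ℝ, ∀ ω p y, B ≤ H p y ω := by
    obtain ⟨R, hR⟩ := hcoer 0
    obtain ⟨M, hM⟩ := hreg_bdd (max R 1) (by positivity)
    refine ⟨min 0 (-M), fun ω p y => ?_⟩
    rcases le_total R ‖p‖ with h | h
    · exact (min_le_left _ _).trans (hR ω p y h)
    · exact (min_le_right _ _).trans (abs_le.1 (hM ω p y (h.trans (le_max_left _ _)))).1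
  have hb : ∀ ω, ∀ R : ℝ, 0 < R → ∃ M : ℝ, ∀ p y : Ed d, ‖p‖ ≤ R → |H p y ω| ≤ M := by
    intro ω R hR
    obtain ⟨M, hM⟩ := hreg_bdd R hR
    exact ⟨M, hM ω⟩
  have hlow : ∀ p : Ed d, Hs ≤ HbarP p := by
    intro p
    by_contra! hlt
    obtain ⟨ν, hν1, hν2⟩ := exists_between hlt
    obtain ⟨ω, h1, h2⟩ := ((hHbarP p).and hHs).exists
    rw [HbarPlusOm_eq] at h1
    obtain ⟨w, hw, hwν⟩ := InfSup_lt (SL_sub d) (zero_SL d) (hb ω) (h1.trans_lt hν1)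
    rw [HstarOm_eq] at h2
    obtain ⟨C, hC⟩ := hw.1
    have := InfSup_le (p := 0) (ν := ν) subset_rfl (hb ω) (hB ω) (lip_add_inner hw.1 p) (by
      filter_upwards [hwν, hC.ae_differentiableAt] with y hy hdy
      rwa [grad_add_inner hdy, zero_add])
    linarith
  refine ⟨?_, hlow⟩
  obtain ⟨L₀, hL₀⟩ := hcoer (Hs + 2)
  set L := max L₀ 1 with hLd
  have hL0 : 0 < L := by positivity
  have hL : ∀ ω p y, H p y ω ≤ Hs + 1 → ‖p‖ ≤ L := by
    intro ω p y h
    by_contra! hlt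
    have := hL₀ ω p y ((le_max_left _ _).trans hlt.le)
    linarith
  have hw : ∀ μ, Hs < μ → ∀ᵐ ω ∂P, ∃ w ∈ LipFuns d, ∀ᵐ y : Ed d, H (gradient w y) y ω ≤ μ := by
    intro μ hμ
    filter_upwards [hHs] with ω hω
    rw [HstarOm_eq] at hω
    have := InfSup_lt subset_rfl (zero_Lip d) (hb ω) (hω.trans_lt hμ)
    simpa only [zero_add] using this
  have hpn : ∀ n : ℕ, ∃ p : Ed d, ‖p‖ ≤ L ∧ HbarP p ≤ Hs + 1 / ((n : ℝ) + 1) := by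
    intro n
    have hn0 : (0 : ℝ) < 1 / ((n : ℝ) + 1) := by positivity
    have hn1 : 1 / ((n : ℝ) + 1) ≤ 1 := by
      rw [div_le_one (by positivity)]
      linarith [Nat.cast_nonneg (α := ℝ) n]
    obtain ⟨p, hp, hpw⟩ := key hτmp hτgrp hτzero hτerg hHmeas hHstat hHcont hreg_uc hqc
      (ν := Hs + 1 / ((n : ℝ) + 1)) (by linarith) hL0
      (fun ω p y h => hL ω p y (by linarith)) hw
    refine ⟨p, hp, ?_⟩
    obtain ⟨ω, h1, w, hwS, hwν⟩ := ((hHbarP p).and hpw).exists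
    rw [HbarPlusOm_eq] at h1
    rw [← h1]
    exact InfSup_le (SL_sub d) (hb ω) (hB ω) hwS hwν
  choose q hqL hq using hpn
  obtain ⟨p, -, φ, hφ, hlim⟩ := (isCompact_closedBall (0 : Ed d) L).tendsto_subseq
    (x := q) fun n => by simpa using hqL n
  refine ⟨p, le_antisymm ?_ (hlow p)⟩
  refine le_of_forall_pos_le_add fun ε' hε' => ?_
  obtain ⟨ε, hε, hεε', hε1⟩ : ∃ ε : ℝ, 0 < ε ∧ ε ≤ ε' ∧ ε ≤ 1 :=
    ⟨min ε' 1, by positivity, min_le_left _ _, min_le_right _ _⟩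
  obtain ⟨δ, hδ, huc⟩ := hreg_uc (L + 1) (by positivity) (ε / 2) (by positivity)
  have h1 : ∀ᶠ n in atTop, dist (q (φ n)) p < min δ 1 :=
    (tendsto_order.1 (tendsto_iff_dist_tendsto_zero.1 hlim)).2 _ (by positivity)
  have h2 : ∀ᶠ n in atTop, 1 / (((φ n : ℕ) : ℝ) + 1) < ε / 2 :=
    (tendsto_order.1 (tendsto_one_div_add_atTop_nhds_zero_nat.comp hφ.tendsto_atTop)).2 _
      (by positivity)
  obtain ⟨n, hn1, hn2⟩ := (h1.and h2).exists
  have hn3 := hq (φ n)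
  obtain ⟨ω, hω1, hω2⟩ := ((hHbarP (q (φ n))).and (hHbarP p)).exists
  rw [HbarPlusOm_eq] at hω1 hω2
  obtain ⟨w, hwS, hwν⟩ := InfSup_lt (ν := Hs + ε / 2) (SL_sub d) (zero_SL d) (hb ω)
    (p := q (φ n)) (by rw [hω1]; linarith)
  rw [← hω2]
  refine InfSup_le (SL_sub d) (hb ω) (hB ω) hwS ?_
  filter_upwards [hwν] with y hy
  rw [dist_eq_norm, lt_min_iff] at hn1
  have hg := hL ω _ y (show H (q (φ n) + gradient w y) y ω ≤ Hs + 1 by linarith)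
  have e : (q (φ n) + gradient w y) - (p + gradient w y) = q (φ n) - p := by abel
  have hg2 : ‖p + gradient w y‖ ≤ L + 1 := by
    have e2 : p + gradient w y = (q (φ n) + gradient w y) - (q (φ n) - p) := by abel
    rw [e2]
    linarith [norm_sub_le (q (φ n) + gradient w y) (q (φ n) - p)]
  have := huc ω (q (φ n) + gradient w y) (p + gradient w y) y y (by linarith) hg2
    (by rw [e]; exact hn1.1) (by simpa using hδ)
  rw [abs_lt] at this
  linarith [this.1]
end
end
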